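/- Assume R is unmixed of dimension d ≥ 2. Then for every C-parameter ideal q of R one has e_1(q :_R m, R) − e_1(q, R) ≤ f_0(q, R). -/

import Mathlib

/-! Preliminary definitions: lengths, dimensions, (C-)systems of parameters, Hilbert
coefficients, irreducible multiplicities, local cohomology invariants, stable values,
unmixedness, the unmixed component, and the g-invariant. -/

open CategoryTheory CategoryTheory.Limits Opposite IsLocalRing

universe u

noncomputable section

section Definitions

variable (R : Type u) [CommRing R]

/-- The length of an `R`-module, defined as the Krull dimension of its submodule lattice. -/
def moduleLength (M : Type u) [AddCommGroup M] [Module R M] : WithBot ℕ∞ :=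
  Order.krullDim (Submodule R M)

/-- The Krull dimension of an `R`-module `M`, i.e. `dim (R / Ann M)`. -/
def moduleDim (M : Type u) [AddCommGroup M] [Module R M] : WithBot ℕ∞ :=
  ringKrullDim (R ⧸ Module.annihilator R M)

/-- The colon submodule `(N :_M I) = {x : M | I • x ⊆ N}`. -/
def modColon {M : Type u} [AddCommGroup M] [Module R M] (N : Submodule R M) (I : Ideal R) :
    Submodule R M where
  carrier := {x | ∀ r ∈ I, r • x ∈ N}
  add_mem' := by
    intro a b ha hb r hr
    simpa [smul_add] using N.add_mem (ha r hr) (hb r hr)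
  zero_mem' := by
    intro r hr
    simpa using N.zero_mem
  smul_mem' := by
    intro c a ha r hr
    rw [smul_comm]
    exact N.smul_mem c (ha r hr)

/-- `x : Fin s → R` is a system of parameters of the module `M`:
`s = dim M`, the `x i` are nonunits, and `M/(x)M` has finite length. -/
def IsSOP (M : Type u) [AddCommGroup M] [Module R M] {s : ℕ} (x : Fin s → R) : Prop :=
  moduleDim R M = (s : WithBot ℕ∞) ∧ (∀ i, x i ∈ nonunits R) ∧
    IsFiniteLength R (M ⧸ (Ideal.span (Set.range x) • (⊤ : Submodule R M)))

/-- The ideal `b(M)`: the intersection, over all systems of parameters `x` of `M` and all `i`,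
of `Ann_R ((0) :_{M/(x_1,...,x_{i-1})M} x_i)`. -/
def bIdeal (M : Type u) [AddCommGroup M] [Module R M] : Ideal R :=
  ⨅ (s : ℕ) (x : Fin s → R) (_ : IsSOP R M x) (i : Fin s),
    (Submodule.torsionBy R
      (M ⧸ (Ideal.span (x '' {j | j < i}) • (⊤ : Submodule R M))) (x i)).annihilator

/-- `x` is a C-system of parameters of `M`: a system of parameters such that
`x i ∈ b(M/(x_{i+1},...,x_s)M)^3` for every `i` (for `i = s` the quotient is `M` itself). -/
def IsCSOP (M : Type u) [AddCommGroup M] [Module R M] {s : ℕ} (x : Fin s → R) : Prop :=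
  IsSOP R M x ∧ ∀ i : Fin s,
    x i ∈ (bIdeal R (M ⧸ (Ideal.span (x '' {j | i < j}) • (⊤ : Submodule R M)))) ^ 3

/-- A parameter ideal of `R`. -/
def IsParamIdeal (q : Ideal R) : Prop :=
  ∃ (s : ℕ) (x : Fin s → R), IsSOP R R x ∧ q = Ideal.span (Set.range x)

/-- A C-parameter ideal of `R`: an ideal generated by a C-system of parameters of `R`. -/
def IsCParamIdeal (q : Ideal R) : Prop :=
  ∃ (s : ℕ) (x : Fin s → R), IsCSOP R R x ∧ q = Ideal.span (Set.range x)

/-- A C-parameter ideal of a module `M`. -/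
def IsCParamIdealMod (M : Type u) [AddCommGroup M] [Module R M] (q : Ideal R) : Prop :=
  ∃ (s : ℕ) (x : Fin s → R), IsCSOP R M x ∧ q = Ideal.span (Set.range x)

/-- `e` is the family of Hilbert coefficients of `M` (of dimension `s`) with respect to `I`:
`ℓ(M/I^{n+1}M) = ∑_{i=0}^{s} (-1)^i (e i) binom(n+s-i, s-i)` for all large `n`. -/
def IsHilbCoeffMod (I : Ideal R) (M : Type u) [AddCommGroup M] [Module R M] (s : ℕ)
    (e : ℕ → ℤ) : Prop :=
  ∃ N : ℕ, ∀ n ≥ N, ∃ L : ℕ,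
    moduleLength R (M ⧸ (I ^ (n + 1) • (⊤ : Submodule R M))) = (L : WithBot ℕ∞) ∧
    (L : ℤ) = ∑ i ∈ Finset.range (s + 1),
      (-1) ^ i * e i * ((n + s - i).choose (s - i) : ℤ)

/-- `e` is the family of Hilbert coefficients of `R` (of dimension `d`) with respect to `I`;
`e 1` is the Chern number of `I`. -/
def IsHilbCoeff (I : Ideal R) (d : ℕ) (e : ℕ → ℤ) : Prop :=
  IsHilbCoeffMod R I R d e

variable [IsLocalRing R]

/-- The colon ideal `(q :_R m)`. -/
def colonIdeal (q : Ideal R) : Ideal R :=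
  modColon R q (maximalIdeal R)

/-- The index of reducibility `ir_M(q) = ℓ((qM :_M m)/qM)`. -/
def irMod (M : Type u) [AddCommGroup M] [Module R M] (q : Ideal R) : WithBot ℕ∞ :=
  moduleLength R
    ↥(Submodule.map (q • (⊤ : Submodule R M)).mkQ
      (modColon R (q • (⊤ : Submodule R M)) (maximalIdeal R)))

/-- `NN` is the stable value `𝒩(M)` of `M`: the common index of reducibility of all
C-parameter ideals of `M`. -/
def IsStableValueMod (M : Type u) [AddCommGroup M] [Module R M] (NN : ℕ) : Prop :=
  ∀ q : Ideal R, IsCParamIdealMod R M q → irMod R M q = (NN : WithBot ℕ∞)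

/-- `NN` is the stable value `𝒩(R)` of `R`. -/
def IsStableValue (NN : ℕ) : Prop :=
  ∀ q : Ideal R, IsCParamIdeal R q → irMod R R q = (NN : WithBot ℕ∞)

/-- `f` is the family of coefficients of the polynomial giving the index of reducibility,
`ir_M(I^{n+1}) = ℓ((I^{n+1}M :_M m)/I^{n+1}M) = ∑_{i=0}^{s-1} (-1)^i (f i) binom(n+s-1-i, s-1-i)`
for all large `n`; `f 0` is the irreducible multiplicity of `M` with respect to `I`. -/
def IsIrrCoeffMod (I : Ideal R) (M : Type u) [AddCommGroup M] [Module R M] (s : ℕ)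
    (f : ℕ → ℤ) : Prop :=
  ∃ N : ℕ, ∀ n ≥ N, ∃ L : ℕ,
    irMod R M (I ^ (n + 1)) = (L : WithBot ℕ∞) ∧
    (L : ℤ) = ∑ i ∈ Finset.range s,
      (-1) ^ i * f i * ((n + s - 1 - i).choose (s - 1 - i) : ℤ)

/-- Ring version of `IsIrrCoeffMod`. -/
def IsIrrCoeff (I : Ideal R) (d : ℕ) (f : ℕ → ℤ) : Prop :=
  IsIrrCoeffMod R I R d f

/-- The local cohomology module `H^i_m(M)`. -/
def Hmod (M : Type u) [AddCommGroup M] [Module R M] (i : ℕ) : ModuleCat.{u} R :=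
  (localCohomology (maximalIdeal R) i).obj (ModuleCat.of R M)

/-- `r_i(M) = ℓ((0) :_{H^i_m(M)} m)`, the length of the socle of `H^i_m(M)`. -/
def rLengthMod (M : Type u) [AddCommGroup M] [Module R M] (i : ℕ) : WithBot ℕ∞ :=
  moduleLength R ↥(Submodule.torsionBySet R ↥(Hmod R M i) ((maximalIdeal R : Ideal R) : Set R))

/-- `r_i(R)`. -/
def rLength (i : ℕ) : WithBot ℕ∞ := rLengthMod R R i

/-- `M` is a Cohen-Macaulay `R`-module: `H^i_m(M) = 0` for all `i < dim M`. -/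
def IsCMMod (M : Type u) [AddCommGroup M] [Module R M] : Prop :=
  ∀ i : ℕ, (i : WithBot ℕ∞) < moduleDim R M → Subsingleton ↥(Hmod R M i)

/-- `R` is a Cohen-Macaulay local ring: `H^i_m(R) = 0` for all `i < dim R`. -/
def IsCMLocal : Prop :=
  ∀ i : ℕ, (i : WithBot ℕ∞) < ringKrullDim R → Subsingleton ↥(Hmod R R i)

/-- `R` is a generalized Cohen-Macaulay local ring:
`H^i_m(R)` has finite length for all `i < dim R`. -/
def IsGeneralizedCM : Prop :=
  ∀ i : ℕ, (i : WithBot ℕ∞) < ringKrullDim R → IsFiniteLength R ↥(Hmod R R i)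

/-- `R` is a Gorenstein local ring: Cohen-Macaulay of type `r_d(R) = 1`, `d = dim R`. -/
def IsGorensteinLocal : Prop :=
  IsCMLocal R ∧ ∀ d : ℕ, ringKrullDim R = (d : WithBot ℕ∞) → rLength R d = (1 : WithBot ℕ∞)

/-- `R` is unmixed: `dim R̂/p = dim R̂` for every associated prime `p` of the
`m`-adic completion `R̂` of `R`. -/
def IsUnmixedRing : Prop :=
  ∀ p ∈ associatedPrimes (AdicCompletion (maximalIdeal R) R) (AdicCompletion (maximalIdeal R) R),
    ringKrullDim ((AdicCompletion (maximalIdeal R) R) ⧸ p) =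
      ringKrullDim (AdicCompletion (maximalIdeal R) R)

/-- `M` is unmixed: `dim R̂/p = dim M̂` for every associated prime `p` of the
`m`-adic completion `M̂` of `M`, viewed over `R̂`. -/
def IsUnmixedMod (M : Type u) [AddCommGroup M] [Module R M] : Prop :=
  ∀ p ∈ associatedPrimes (AdicCompletion (maximalIdeal R) R) (AdicCompletion (maximalIdeal R) M),
    ringKrullDim ((AdicCompletion (maximalIdeal R) R) ⧸ p) =
      moduleDim (AdicCompletion (maximalIdeal R) R) (AdicCompletion (maximalIdeal R) M)

/-- `H^0_m(M)`, described as the submodule of elements killed by a power of `m`. -/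
def H0Sub (M : Type u) [AddCommGroup M] [Module R M] : Submodule R M :=
  ⨆ n : ℕ, Submodule.torsionBySet R M (((maximalIdeal R) ^ n : Ideal R) : Set R)

/-- The unmixed component `u = U_R(0)` of `R`: the largest ideal of dimension `< dim R`. -/
def unmixedComponent : Ideal R := sSup {J : Ideal R | moduleDim R ↥J < ringKrullDim R}

end Definitions

section CMImage

/-- `R` is a homomorphic image of a Cohen-Macaulay (Noetherian) local ring. -/
def IsHomImageOfCM (R : Type u) [CommRing R] : Prop :=
  ∃ (A : Type u) (_ : CommRing A) (_ : IsLocalRing A) (_ : IsNoetherianRing A),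
    IsCMLocal A ∧ ∃ f : A →+* R, Function.Surjective f

end CMImage

section GInvariant

variable (R : Type u) [CommRing R] [IsLocalRing R] [IsNoetherianRing R]

/-- The canonical homomorphism from `Ext^p(R/q, R)` (the term of the directed system indexed by
the ideal `q` with `J ≤ rad q`) into the local cohomology module `H^p_J(R)`, given by the
structure of `H^p_J(R)` as an inductive limit. -/
def canonicalToLocalCohomology (J q : Ideal R) (h : J ≤ q.radical) (p : ℕ) :
    ((localCohomology.diagram (localCohomology.selfLERadicalDiagram J) p).obj
        (op (⟨q, h⟩ : localCohomology.SelfLERadical J))).obj (ModuleCat.of R R) ⟶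
      (localCohomology J p).obj (ModuleCat.of R R) :=
  haveI := localCohomology.hasColimitDiagram.{u, u} (localCohomology.selfLERadicalDiagram J) p
  (colimit.ι (localCohomology.diagram (localCohomology.selfLERadicalDiagram J) p)
      (op (⟨q, h⟩ : localCohomology.SelfLERadical J))).app (ModuleCat.of R R) ≫
    (localCohomology.isoSelfLERadical J p).hom.app (ModuleCat.of R R)

/-- A map of `R`-modules is surjective on socles. -/
def SurjectiveOnSocles {A B : ModuleCat.{u} R} (φ : A ⟶ B) : Prop :=
  ∀ y ∈ Submodule.torsionBySet R ↥B ((maximalIdeal R : Ideal R) : Set R),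
    ∃ z ∈ Submodule.torsionBySet R ↥A ((maximalIdeal R : Ideal R) : Set R), φ z = y

/-- The defining property of the g-invariant: for every system of parameters `x` of `R`
contained in `m^(n₀)` and every `p`, the canonical homomorphism into the local cohomology
module `H^p_m(R)` is surjective on the socles. -/
def GProperty (n₀ : ℕ) : Prop :=
  ∀ (s : ℕ) (x : Fin s → R), IsSOP R R x → (∀ i, x i ∈ maximalIdeal R ^ n₀) →
    ∀ (h : maximalIdeal R ≤ (Ideal.span (Set.range x)).radical) (p : ℕ),
      SurjectiveOnSocles R
        (canonicalToLocalCohomology R (maximalIdeal R) (Ideal.span (Set.range x)) h p)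

/-- The g-invariant `g(R)`: the least `n₀` satisfying `GProperty`. -/
def gInvariant : ℕ := sInf {n₀ : ℕ | GProperty R n₀}

end GInvariant

end

section AnalyticIndependence

/-- Evaluating a homogeneous polynomial at a rescaled point. -/
theorem MvPolynomial.IsHomogeneous.aeval_mul_left {R S σ : Type*} [CommRing R] [CommRing S]
    [Algebra R S] [Fintype σ] {F : MvPolynomial σ R} {n : ℕ} (hF : F.IsHomogeneous n)
    (c : S) (g : σ → S) :
    MvPolynomial.aeval (fun i => c * g i) F = c ^ n * MvPolynomial.aeval g F := by
  simp only [MvPolynomial.aeval_def, MvPolynomial.eval₂_eq', Finset.mul_sum]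
  refine Finset.sum_congr rfl fun α hα => ?_
  have h : ∑ i, α i = n := by
    rw [← hF (MvPolynomial.mem_support_iff.mp hα), Finsupp.weight_apply,
      Finsupp.sum_fintype _ _ (by simp)]
    simp
  simp only [mul_pow, Finset.prod_mul_distrib, Finset.prod_pow_eq_pow_sum, h]
  ring

variable {R : Type*} [CommRing R] [IsLocalRing R] [IsNoetherianRing R]

/-- Homogeneous relations on a system of parameters have coefficients in the maximal ideal. -/
theorem coeff_mem_maximalIdeal_of_aeval_eq_zero {d : ℕ} (hd : (d : WithBot ℕ∞) ≤ ringKrullDim R)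
    (z : Fin d → R)
    (hrad : maximalIdeal R ≤ (Ideal.span (Set.range z)).radical) {n : ℕ}
    (F : MvPolynomial (Fin d) R) (hF : F.IsHomogeneous n) (h0 : MvPolynomial.aeval z F = 0)
    (hz : ∀ i, z i ∈ maximalIdeal R)
    (α : Fin d →₀ ℕ) : F.coeff α ∈ maximalIdeal R := by
  classical
  by_contra hα
  let P : Ideal (Polynomial R) := (maximalIdeal R).map Polynomial.C
  have hP : P.IsPrime := Ideal.isPrime_map_C_of_isPrime
  have hPh : P.height = (maximalIdeal R).height := Polynomial.height_map_C _
  have hdP : (d : ℕ∞) ≤ P.height := by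
    rw [hPh]
    rw [← IsLocalRing.maximalIdeal_height_eq_ringKrullDim] at hd
    exact_mod_cast hd
  let π : Polynomial R →+* Polynomial (ResidueField R) := Polynomial.mapRingHom (residue R)
  have hπ : ∀ p, p ∈ P ↔ π p = 0 := by
    intro p
    rw [Ideal.mem_map_C_iff, Polynomial.ext_iff]
    refine forall_congr' fun n => ?_
    simp [π, Polynomial.coeff_map]
  let F' : MvPolynomial (Fin d) (Polynomial (ResidueField R)) :=
    MvPolynomial.map (π.comp Polynomial.C) F
  have hF' : F' ≠ 0 := by
    intro h
    apply hα
    have := congrArg (MvPolynomial.coeff α) h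
    simp only [F', MvPolynomial.coeff_map, MvPolynomial.coeff_zero] at this
    simpa [π] using this
  obtain ⟨l', hl'⟩ : ∃ l, MvPolynomial.eval l F' ≠ 0 := by
    by_contra! h
    exact hF' (MvPolynomial.funext fun x => by simpa using h x)
  have hsurj : Function.Surjective π := Polynomial.map_surjective _ residue_surjective
  choose l hl using fun i => hsurj (l' i)
  have hFl : MvPolynomial.aeval l F ∉ P := by
    rw [hπ]
    convert hl'
    simp only [F', MvPolynomial.eval_map, MvPolynomial.aeval_def]
    rw [← MvPolynomial.coe_eval₂Hom, MvPolynomial.map_eval₂Hom]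
    simp only [MvPolynomial.coe_eval₂Hom, hl]
    rfl
  have hFz : MvPolynomial.aeval (fun i => Polynomial.C (z i)) F = 0 := by
    have := MvPolynomial.aeval_algebraMap_apply (B := Polynomial R) z F
    rw [h0, map_zero] at this
    exact this
  obtain ⟨i₀, hi₀⟩ : ∃ i, l i ∉ P := by
    by_contra! h
    have h1 : l' = fun i => 0 * (1 : Polynomial (ResidueField R)) := by
      funext i; rw [← hl, (hπ _).mp (h i), zero_mul]
    have hF'h : F'.IsHomogeneous n := hF.map _
    have := hF'h.aeval_mul_left (S := Polynomial (ResidueField R)) 0 (fun _ => 1)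
    rw [← h1, MvPolynomial.aeval_eq_eval] at this
    rcases Nat.eq_zero_or_pos n with rfl | hn
    · have hF0 : F = MvPolynomial.C (F.coeff 0) := by
        rw [← MvPolynomial.totalDegree_eq_zero_iff_eq_C]
        exact Nat.le_zero.mp hF.totalDegree_le
      rw [hF0] at h0
      simp only [MvPolynomial.aeval_C] at h0
      have h00 : F.coeff 0 = 0 := h0
      rw [h00, map_zero] at hF0
      exact hα (by simp [hF0])
    · rw [zero_pow hn.ne', zero_mul] at this
      exact hl' this
  let w : Fin d → Polynomial R := fun j => l i₀ * Polynomial.C (z j) - Polynomial.C (z i₀) * l j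
  let s : Finset (Polynomial R) := (Finset.univ.erase i₀).image w
  have hzP : ∀ j, Polynomial.C (z j) ∈ P := fun j => Ideal.mem_map_of_mem _ (hz j)
  have hsP : Ideal.span (s : Set (Polynomial R)) ≤ P := by
    rw [Ideal.span_le]
    intro x hx
    simp only [s, Finset.coe_image] at hx
    obtain ⟨j, -, rfl⟩ := hx
    exact P.sub_mem (P.mul_mem_left _ (hzP j)) (P.mul_mem_right _ (hzP i₀))
  have hmin : P ∈ (Ideal.span (s : Set (Polynomial R))).minimalPrimes := by
    refine ⟨⟨hP, hsP⟩, ?_⟩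
    rintro Q ⟨hQ, hsQ⟩ hQP
    have hw : ∀ j, w j ∈ Q := by
      intro j
      by_cases hj : j = i₀
      · subst hj; simp [w, mul_comm]
      · exact hsQ (Ideal.subset_span
          (Finset.mem_coe.mpr (Finset.mem_image_of_mem _ (by simp [hj]))))
    have hz0 : Polynomial.C (z i₀) ∈ Q := by
      have h1 := hF.aeval_mul_left (l i₀) (fun i => Polynomial.C (z i))
      have h2 := hF.aeval_mul_left (Polynomial.C (z i₀)) l
      rw [hFz, mul_zero] at h1
      have h3 : MvPolynomial.aeval (fun i => Polynomial.C (z i₀) * l i) F ∈ Q := by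
        rw [← Ideal.Quotient.eq_zero_iff_mem]
        have h4 : ∀ g : Fin d → Polynomial R,
            Ideal.Quotient.mk Q (MvPolynomial.aeval g F)
              = MvPolynomial.aeval (fun i => Ideal.Quotient.mk Q (g i)) F := by
          intro g
          exact MvPolynomial.comp_aeval_apply (Ideal.Quotient.mkₐ R Q) (f := g) F
        have h5 := congrArg (Ideal.Quotient.mk Q) h1
        rw [h4, map_zero] at h5
        rw [h4, ← h5]
        congr 2
        funext i
        exact ((Ideal.Quotient.mk_eq_mk_iff_sub_mem _ _).mpr (hw i)).symm
      rw [h2] at h3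
      rcases hQ.mem_or_mem h3 with h | h
      · exact hQ.mem_of_pow_mem _ h
      · exact absurd (hQP h) hFl
    have hzj : ∀ j, Polynomial.C (z j) ∈ Q := by
      intro j
      have : l i₀ * Polynomial.C (z j) ∈ Q := by
        have := Q.add_mem (hw j) (Q.mul_mem_right (l j) hz0)
        simpa [w] using this
      exact (hQ.mem_or_mem this).resolve_left fun h => hi₀ (hQP h)
    refine Ideal.map_le_iff_le_comap.mpr (hrad.trans ?_)
    rw [(hQ.comap Polynomial.C).radical_le_iff, Ideal.span_le]
    rintro _ ⟨j, rfl⟩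
    exact hzj j
  have hcard := Ideal.height_le_card_of_mem_minimalPrimes_span_finset hmin
  have hs : s.card ≤ d - 1 := by
    refine Finset.card_image_le.trans ?_
    rw [Finset.card_erase_of_mem (Finset.mem_univ _), Finset.card_univ, Fintype.card_fin]
  have hd0 : 0 < d := i₀.pos
  have : (d : ℕ∞) ≤ ((d - 1 : ℕ) : ℕ∞) := hdP.trans (hcard.trans (by exact_mod_cast hs))
  have := Nat.cast_le.mp this
  omega

end AnalyticIndependence

section MonomialIdeal

/-- The ideal generated by the monomials in `z` with exponents in `S`. -/
def monomialIdeal {R : Type*} [CommRing R] {d : ℕ} (z : Fin d → R) (S : Set (Fin d → ℕ)) :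
    Ideal R :=
  Ideal.span ((fun α : Fin d → ℕ => ∏ i, z i ^ α i) '' S)

variable {R : Type*} [CommRing R] {d : ℕ}

theorem prod_pow_mem_monomialIdeal (z : Fin d → R) {S : Set (Fin d → ℕ)} {α : Fin d → ℕ}
    (h : α ∈ S) : ∏ i, z i ^ α i ∈ monomialIdeal z S :=
  Ideal.subset_span ⟨α, h, rfl⟩

theorem monomialIdeal_mono (z : Fin d → R) {S T : Set (Fin d → ℕ)} (h : S ⊆ T) :
    monomialIdeal z S ≤ monomialIdeal z T :=
  Ideal.span_mono (Set.image_mono h)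

theorem monomialIdeal_mul (z : Fin d → R) (S T : Set (Fin d → ℕ)) :
    monomialIdeal z S * monomialIdeal z T = monomialIdeal z (Set.image2 (· + ·) S T) := by
  rw [monomialIdeal, monomialIdeal, monomialIdeal, Ideal.span_mul_span']
  congr 1
  ext x
  simp only [Set.mem_mul, Set.mem_image, Set.mem_image2]
  constructor
  · rintro ⟨_, ⟨α, hα, rfl⟩, _, ⟨β, hβ, rfl⟩, rfl⟩
    exact ⟨_, ⟨α, hα, β, hβ, rfl⟩, by simp [pow_add, Finset.prod_mul_distrib]⟩
  · rintro ⟨_, ⟨α, hα, β, hβ, rfl⟩, rfl⟩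
    exact ⟨_, ⟨α, hα, rfl⟩, _, ⟨β, hβ, rfl⟩, by simp [pow_add, Finset.prod_mul_distrib]⟩

/-- The ideal generated by the monomials in `z` of weight at least `n`. -/
def weightIdeal (z : Fin d → R) (w : Fin d → ℕ) (n : ℕ) : Ideal R :=
  monomialIdeal z {α | n ≤ ∑ i, w i * α i}

theorem prod_pow_mem_weightIdeal (z : Fin d → R) (w α : Fin d → ℕ) {n : ℕ}
    (h : n ≤ ∑ i, w i * α i) : ∏ i, z i ^ α i ∈ weightIdeal z w n :=
  prod_pow_mem_monomialIdeal z h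

theorem weightIdeal_mul_le (z : Fin d → R) (w : Fin d → ℕ) (a b : ℕ) :
    weightIdeal z w a * weightIdeal z w b ≤ weightIdeal z w (a + b) := by
  rw [weightIdeal, weightIdeal, monomialIdeal_mul]
  refine monomialIdeal_mono z ?_
  rintro _ ⟨α, hα, β, hβ, rfl⟩
  simp only [Set.mem_ofPred_eq, Pi.add_apply, mul_add, Finset.sum_add_distrib] at *
  omega

theorem weightIdeal_zero (z : Fin d → R) (w : Fin d → ℕ) : weightIdeal z w 0 = ⊤ := by
  rw [Ideal.eq_top_iff_one]
  have := prod_pow_mem_weightIdeal z w 0 (n := 0) (by simp)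
  simpa using this

theorem weightIdeal_anti (z : Fin d → R) (w : Fin d → ℕ) {a b : ℕ} (h : a ≤ b) :
    weightIdeal z w b ≤ weightIdeal z w a :=
  monomialIdeal_mono z fun _ hα => h.trans hα

theorem mem_weightIdeal_single (z : Fin d → R) (w : Fin d → ℕ) (i : Fin d) (n : ℕ) :
    z i ^ n ∈ weightIdeal z w (w i * n) := by
  classical
  have := prod_pow_mem_weightIdeal z w (Pi.single i n) (n := w i * n)
    (by simp [Pi.single_apply])
  simpa [Pi.single_apply, Finset.prod_pow_boole, pow_ite] using this

theorem pow_mem_weightIdeal (z : Fin d → R) (w : Fin d → ℕ) {a : ℕ} {x : R}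
    (hx : x ∈ weightIdeal z w a) (s : ℕ) : x ^ s ∈ weightIdeal z w (s * a) := by
  induction s with
  | zero => simp [weightIdeal_zero]
  | succ s ih =>
    rw [pow_succ, Nat.succ_mul]
    exact weightIdeal_mul_le z w _ _ (Ideal.mul_mem_mul ih hx)

theorem span_pow_succ_le_mul [IsLocalRing R] (z : Fin d → R)
    (hz : ∀ i, z i ∈ maximalIdeal R) (n : ℕ) :
    Ideal.span (Set.range z) ^ (n + 1) ≤ maximalIdeal R * Ideal.span (Set.range z) ^ n := by
  rw [pow_succ']
  refine Ideal.mul_mono_left ?_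
  rw [Ideal.span_le]
  rintro _ ⟨i, rfl⟩
  exact hz i

variable [IsLocalRing R] [IsNoetherianRing R]

/-- Monomials in a system of parameters are analytically independent. -/
theorem prod_pow_notMem_mul_pow (hd : (d : WithBot ℕ∞) ≤ ringKrullDim R) (z : Fin d → R)
    (hz : ∀ i, z i ∈ maximalIdeal R)
    (hrad : maximalIdeal R ≤ (Ideal.span (Set.range z)).radical) (F : MvPolynomial (Fin d) R)
    {n : ℕ} (hF : F.IsHomogeneous n) {α : Fin d →₀ ℕ} (hα : F.coeff α ∉ maximalIdeal R) :
    MvPolynomial.aeval z F ∉ maximalIdeal R * Ideal.span (Set.range z) ^ n := by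
  intro h
  have key : ∀ x ∈ maximalIdeal R * Ideal.span (Set.range z) ^ n,
      ∃ G : MvPolynomial (Fin d) R, G.IsHomogeneous n ∧ (∀ β, G.coeff β ∈ maximalIdeal R) ∧
        MvPolynomial.aeval z G = x := by
    intro x hx
    induction hx using Submodule.mul_induction_on' with
    | mem_mul_mem r hr y hy =>
      obtain ⟨G, hG, rfl⟩ := (Ideal.mem_span_pow_iff_exists_isHomogeneous z y).mp hy
      refine ⟨MvPolynomial.C r * G, hG.C_mul r, fun β => ?_, ?_⟩
      · rw [MvPolynomial.coeff_C_mul]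
        exact Ideal.mul_mem_right _ _ hr
      · rw [map_mul, MvPolynomial.aeval_C, MvPolynomial.aeval_eq_eval]; rfl
    | add x _ y _ hx hy =>
      obtain ⟨G, hG, hG', rfl⟩ := hx
      obtain ⟨H, hH, hH', rfl⟩ := hy
      exact ⟨G + H, hG.add hH, fun β => by
        rw [MvPolynomial.coeff_add]; exact Ideal.add_mem _ (hG' β) (hH' β), map_add _ _ _⟩
  obtain ⟨G, hG, hG', hGF⟩ := key _ h
  have := coeff_mem_maximalIdeal_of_aeval_eq_zero hd z hrad (F - G) (hF.sub hG)
    (by rw [map_sub, hGF, sub_self]) hz α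
  rw [MvPolynomial.coeff_sub] at this
  exact hα (by simpa using Ideal.add_mem _ this (hG' α))

theorem prod_pow_notMem_span_pow_succ (hd : (d : WithBot ℕ∞) ≤ ringKrullDim R) (z : Fin d → R)
    (hz : ∀ i, z i ∈ maximalIdeal R)
    (hrad : maximalIdeal R ≤ (Ideal.span (Set.range z)).radical) (α : Fin d → ℕ) :
    ∏ i, z i ^ α i ∉ Ideal.span (Set.range z) ^ (∑ i, α i + 1) := by
  intro h
  let F : MvPolynomial (Fin d) R := MvPolynomial.monomial (Finsupp.equivFunOnFinite.symm α) 1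
  have hF : F.IsHomogeneous (∑ i, α i) := by
    apply MvPolynomial.isHomogeneous_monomial
    simp [Finsupp.degree_eq_sum]
  refine prod_pow_notMem_mul_pow hd z hz hrad F hF (α := Finsupp.equivFunOnFinite.symm α)
    (by simp [F]) ?_
  convert span_pow_succ_le_mul z hz _ h using 1
  simp [F, MvPolynomial.aeval_monomial, Finsupp.prod_fintype]

/-- Weighted analytic independence of a system of parameters. -/
theorem prod_pow_notMem_weightIdeal (hd : (d : WithBot ℕ∞) ≤ ringKrullDim R) (z : Fin d → R)
    (hz : ∀ i, z i ∈ maximalIdeal R)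
    (hrad : maximalIdeal R ≤ (Ideal.span (Set.range z)).radical)
    (w : Fin d → ℕ) (hw : ∀ i, 0 < w i) (α : Fin d → ℕ) :
    ∏ i, z i ^ α i ∉ weightIdeal z w (∑ i, w i * α i + 1) := by
  intro h
  set n := ∑ i, w i * α i with hn
  let W := ∏ i, w i
  have hW : 0 < W := Finset.prod_pos fun i _ => hw i
  have hdvd : ∀ i, w i ∣ W := fun i => Finset.dvd_prod_of_mem _ (Finset.mem_univ i)
  choose v hv using hdvd
  have hv0 : ∀ i, 0 < v i := fun i => Nat.pos_of_mul_pos_left (hv i ▸ hW)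
  let z' : Fin d → R := fun i => z i ^ v i
  have hz' : ∀ i, z' i ∈ maximalIdeal R := fun i => Ideal.pow_mem_of_mem _ (hz i) _ (hv0 i)
  have hrad' : maximalIdeal R ≤ (Ideal.span (Set.range z')).radical := by
    refine hrad.trans ?_
    rw [Ideal.radical_le_radical_iff, Ideal.span_le]
    rintro _ ⟨i, rfl⟩
    exact ⟨v i, Ideal.subset_span ⟨i, rfl⟩⟩
  refine prod_pow_notMem_span_pow_succ hd z' hz' hrad' (fun i => (d + 1) * (w i * α i)) ?_
  have hpow := pow_mem_weightIdeal z w h ((d + 1) * W)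
  have he : (∏ i, z i ^ α i) ^ ((d + 1) * W) = ∏ i, z' i ^ ((d + 1) * (w i * α i)) := by
    rw [← Finset.prod_pow]
    refine Finset.prod_congr rfl fun i _ => ?_
    simp only [z', ← pow_mul]
    rw [hv i]
    ring_nf
  rw [he] at hpow
  refine Ideal.span_le.mpr ?_ hpow
  rintro _ ⟨β, hβ, rfl⟩
  have hβ' : (d + 1) * W * (n + 1) ≤ ∑ i, w i * β i := hβ
  have h1 : ∑ i, w i * β i ≤ W * (∑ i, β i / v i) + d * W := by
    calc ∑ i, w i * β i ≤ ∑ i, (W * (β i / v i) + W) := by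
          refine Finset.sum_le_sum fun i _ => ?_
          have h2 := Nat.div_add_mod (β i) (v i)
          have h3 := Nat.mod_lt (β i) (hv0 i)
          have h4 := hv i
          calc w i * β i = w i * (v i * (β i / v i) + β i % v i) := by rw [h2]
            _ = w i * v i * (β i / v i) + w i * (β i % v i) := by ring
            _ ≤ w i * v i * (β i / v i) + w i * v i := by gcongr
            _ = _ := by rw [← h4]
      _ = _ := by simp [Finset.sum_add_distrib, Finset.mul_sum]
  have h2 : ∑ i, (d + 1) * (w i * α i) + 1 ≤ ∑ i, β i / v i := by
    rw [← Finset.mul_sum, ← hn]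
    have : W * ((d + 1) * (n + 1)) ≤ W * (∑ i, β i / v i + d) := by
      calc _ = (d + 1) * W * (n + 1) := by ring
        _ ≤ _ := hβ'.trans h1
        _ = _ := by ring
    have := Nat.le_of_mul_le_mul_left this hW
    linarith
  refine Ideal.pow_le_pow_right h2 ?_
  have h3 : ∏ i, z i ^ β i = (∏ i, z' i ^ (β i / v i)) * ∏ i, z i ^ (β i % v i) := by
    rw [← Finset.prod_mul_distrib]
    refine Finset.prod_congr rfl fun i _ => ?_
    simp only [z']
    rw [← pow_mul, ← pow_add, Nat.div_add_mod]
  simp only [h3]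
  refine Ideal.mul_mem_right _ _ ?_
  rw [← Finset.prod_pow_eq_pow_sum]
  exact Ideal.prod_mem_prod fun i _ =>
    Ideal.pow_mem_pow (Ideal.subset_span (Set.mem_range_self i)) _

end MonomialIdeal

section BinomialPolynomials

/-- The value at `n` of the integer-valued polynomial of degree `s` with coefficients `g`
in the signed binomial basis. -/
def binomialSum (s : ℕ) (g : ℕ → ℤ) (n : ℕ) : ℤ :=
  ∑ i ∈ Finset.range (s + 1), (-1) ^ i * g i * ((n + s - i).choose (s - i) : ℤ)

theorem binomialSum_succ (s : ℕ) (g : ℕ → ℤ) (n : ℕ) :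
    binomialSum (s + 1) g n =
      g 0 * ((n + (s + 1)).choose (s + 1) : ℤ) + binomialSum s (fun i => -g (i + 1)) n := by
  rw [binomialSum, Finset.sum_range_succ', add_comm, binomialSum]
  congr 1
  · simp
  · refine Finset.sum_congr rfl fun i hi => ?_
    rw [show n + (s + 1) - (i + 1) = n + s - i by omega, show s + 1 - (i + 1) = s - i by omega]
    ring

theorem abs_binomialSum_le (s : ℕ) (g : ℕ → ℤ) (n : ℕ) :
    |binomialSum s g n| ≤ (∑ i ∈ Finset.range (s + 1), |g i|) * ((n + s).choose s : ℤ) := by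
  rw [binomialSum, Finset.sum_mul]
  refine (Finset.abs_sum_le_sum_abs _ _).trans (Finset.sum_le_sum fun i hi => ?_)
  have hi' : i ≤ s := by simpa [Nat.lt_succ_iff] using hi
  rw [abs_mul, abs_mul, abs_pow, abs_neg, abs_one, one_pow, one_mul, Nat.abs_cast]
  refine mul_le_mul_of_nonneg_left ?_ (abs_nonneg _)
  have h1 : (n + s - i).choose (s - i) = (n + s - i).choose n :=
    Nat.choose_symm_of_eq_add (by omega)
  have h2 : (n + s).choose s = (n + s).choose n := Nat.choose_symm_of_eq_add (by omega)
  rw [h1, h2]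
  exact_mod_cast Nat.choose_le_choose _ (by omega)

/-- The leading coefficient of an eventually nonnegative polynomial is nonnegative. -/
theorem zero_le_of_binomialSum_nonneg {s : ℕ} {g : ℕ → ℤ} {N : ℕ}
    (h : ∀ n ≥ N, 0 ≤ binomialSum s g n) : 0 ≤ g 0 := by
  rcases s with _ | s
  · simpa [binomialSum] using h N le_rfl
  by_contra! hg
  let K : ℤ := ∑ i ∈ Finset.range (s + 1), |(fun i => -g (i + 1)) i|
  have hK : 0 ≤ K := Finset.sum_nonneg fun i _ => abs_nonneg _
  let n := N + (s + 1) * K.toNat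
  have h1 := h n (by simp [n])
  rw [binomialSum_succ] at h1
  have h2 := (le_abs_self _).trans (abs_binomialSum_le s (fun i => -g (i + 1)) n)
  have h3 : ((n + s + 1 : ℕ) : ℤ) * ((n + s).choose s : ℤ) =
      ((n + (s + 1)).choose (s + 1) : ℤ) * ((s + 1 : ℕ) : ℤ) := by
    exact_mod_cast Nat.add_one_mul_choose_eq (n + s) s
  have h4 : (0 : ℤ) < ((n + s).choose s : ℤ) := by
    exact_mod_cast Nat.choose_pos (by omega)
  have h5 : ((s + 1 : ℕ) : ℤ) * K ≤ n := by
    simp only [n]; push_cast; rw [Int.toNat_of_nonneg hK]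
    nlinarith
  have h6 : g 0 * ((n + (s + 1)).choose (s + 1) : ℤ) ≤ -((n + (s + 1)).choose (s + 1) : ℤ) := by
    nlinarith [(Nat.cast_nonneg ((n + (s + 1)).choose (s + 1)) : (0 : ℤ) ≤ _)]
  have h7 : ((n + (s + 1)).choose (s + 1) : ℤ) ≤ K * ((n + s).choose s : ℤ) := by
    change _ ≤ K * _ at h2
    linarith
  have h8 : (0 : ℤ) < ((s + 1 : ℕ) : ℤ) := by positivity
  have h9 := mul_le_mul_of_nonneg_right h7 h8.le
  rw [← h3] at h9
  have h10 := mul_le_mul_of_nonneg_right h5 h4.le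
  push_cast at *
  nlinarith

theorem nonpos_of_binomialSum_nonneg {s : ℕ} {g : ℕ → ℤ} {N : ℕ} (h0 : g 0 = 0)
    (h : ∀ n ≥ N, 0 ≤ binomialSum (s + 1) g n) : g 1 ≤ 0 := by
  have := zero_le_of_binomialSum_nonneg (s := s) (g := fun i => -g (i + 1)) (N := N) fun n hn => by
    have := h n hn
    rwa [binomialSum_succ, h0, zero_mul, zero_add] at this
  simpa using this

theorem binomialSum_sub (s : ℕ) (g h : ℕ → ℤ) (n : ℕ) :
    binomialSum s (fun i => g i - h i) n = binomialSum s g n - binomialSum s h n := by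
  simp only [binomialSum, ← Finset.sum_sub_distrib]
  exact Finset.sum_congr rfl fun i _ => by ring

/-- If the difference of two polynomials of degree `s + 1` lies between zero and a polynomial of
degree `s`, then their subleading coefficients differ by at most its leading coefficient. -/
theorem sub_le_of_binomialSum_sub_le {s : ℕ} {g h f : ℕ → ℤ} {N : ℕ}
    (h1 : ∀ n ≥ N, 0 ≤ binomialSum (s + 1) h n - binomialSum (s + 1) g n)
    (h2 : ∀ n ≥ N, binomialSum (s + 1) h n - binomialSum (s + 1) g n ≤ binomialSum s f n) :
    g 1 - h 1 ≤ f 0 := by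
  let k : ℕ → ℤ := fun i => Nat.casesOn i 0 fun j => -f j
  have hk : ∀ n, binomialSum (s + 1) k n = binomialSum s f n := fun n => by
    simp [binomialSum_succ, k]
  have h3 := zero_le_of_binomialSum_nonneg (s := s + 1) (g := fun i => h i - g i) (N := N)
    fun n hn => by rw [binomialSum_sub]; exact h1 n hn
  have h4 : ∀ n ≥ N, 0 ≤ binomialSum (s + 1) (fun i => k i - (h i - g i)) n := fun n hn => by
    rw [binomialSum_sub, binomialSum_sub, hk]
    linarith [h2 n hn]
  have h5 := zero_le_of_binomialSum_nonneg h4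
  have hk0 : k 0 = 0 := rfl
  have hk1 : k 1 = -f 0 := rfl
  have h6 := nonpos_of_binomialSum_nonneg (by linarith) h4
  linarith

theorem eq_zero_of_binomialSum_eq {s : ℕ} {g : ℕ → ℤ} {N : ℕ} {c : ℤ}
    (h : ∀ n ≥ N, binomialSum (s + 1) g n = c * ((n + (s + 1)).choose (s + 1) : ℤ)) :
    g 1 = 0 := by
  let k : ℕ → ℤ := fun i => Nat.casesOn i c fun _ => 0
  have hk : ∀ n, binomialSum (s + 1) k n = c * ((n + (s + 1)).choose (s + 1) : ℤ) := fun n => by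
    rw [binomialSum_succ]; simp [k, binomialSum]
  have h1 : ∀ n ≥ N, 0 ≤ binomialSum (s + 1) (fun i => g i - k i) n := fun n hn => by
    rw [binomialSum_sub, hk, h n hn, sub_self]
  have h2 : ∀ n ≥ N, 0 ≤ binomialSum (s + 1) (fun i => k i - g i) n := fun n hn => by
    rw [binomialSum_sub, hk, h n hn, sub_self]
  have h3 := zero_le_of_binomialSum_nonneg h1
  have h4 := zero_le_of_binomialSum_nonneg h2
  have h5 := nonpos_of_binomialSum_nonneg (by linarith) h1
  have h6 := nonpos_of_binomialSum_nonneg (by linarith) h2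
  have hk1 : k 1 = 0 := rfl
  linarith

end BinomialPolynomials

section Lengths

variable {R : Type u} [CommRing R]

theorem moduleLength_eq_length (M : Type u) [AddCommGroup M] [Module R M] :
    moduleLength R M = (Module.length R M : WithBot ℕ∞) :=
  (Module.coe_length R M).symm

theorem IsHilbCoeff.length_eq {I : Ideal R} {s : ℕ} {e : ℕ → ℤ} (h : IsHilbCoeff R I s e) :
    ∃ N : ℕ, ∀ n ≥ N, ∃ L : ℕ, Module.length R (R ⧸ I ^ (n + 1)) = L ∧
      (L : ℤ) = binomialSum s e n := by
  obtain ⟨N, hN⟩ := h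
  refine ⟨N, fun n hn => ?_⟩
  obtain ⟨L, hL, hL'⟩ := hN n hn
  refine ⟨L, ?_, hL'⟩
  rw [moduleLength_eq_length, smul_eq_mul, Ideal.mul_top] at hL
  exact_mod_cast hL

theorem IsIrrCoeff.length_eq [IsLocalRing R] {I : Ideal R} {s : ℕ} {f : ℕ → ℤ}
    (h : IsIrrCoeff R I (s + 1) f) :
    ∃ N : ℕ, ∀ n ≥ N, ∃ L : ℕ, Module.length R
        ↥(Submodule.map (I ^ (n + 1)).mkQ (colonIdeal R (I ^ (n + 1)))) = L ∧
      (L : ℤ) = binomialSum s f n := by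
  obtain ⟨N, hN⟩ := h
  refine ⟨N, fun n hn => ?_⟩
  obtain ⟨L, hL, hL'⟩ := hN n hn
  refine ⟨L, ?_, hL'⟩
  rw [irMod, moduleLength_eq_length, smul_eq_mul, Ideal.mul_top] at hL
  exact_mod_cast hL

theorem IsIrrCoeff.zero_le [IsLocalRing R] {I : Ideal R} {s : ℕ} {f : ℕ → ℤ}
    (h : IsIrrCoeff R I (s + 1) f) : 0 ≤ f 0 := by
  obtain ⟨N, hN⟩ := h.length_eq
  refine zero_le_of_binomialSum_nonneg (s := s) (N := N) fun n hn => ?_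
  obtain ⟨L, -, hL⟩ := hN n hn
  omega

/-- Additivity of length along `N ≤ P`. -/
theorem length_quotient_eq_add {M : Type*} [AddCommGroup M] [Module R M] {N P : Submodule R M}
    (h : N ≤ P) :
    Module.length R (M ⧸ N) = Module.length R ↥(P.map N.mkQ) + Module.length R (M ⧸ P) := by
  rw [Module.length_eq_add_of_exact (P.map N.mkQ).subtype (P.map N.mkQ).mkQ
    (Submodule.subtype_injective _) (Submodule.mkQ_surjective _)
    (LinearMap.exact_subtype_mkQ _),
    (Submodule.quotientQuotientEquivQuotient N P h).length_eq]

/-- The inequality of Chern numbers when `m (q : m) = m q`. -/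
theorem chern_sub_le_of_mul_le [IsLocalRing R] {q : Ideal R} {s : ℕ} {e e' f : ℕ → ℤ}
    (h : maximalIdeal R * colonIdeal R q ≤ maximalIdeal R * q)
    (he : IsHilbCoeff R (colonIdeal R q) (s + 1) e) (he' : IsHilbCoeff R q (s + 1) e')
    (hf : IsIrrCoeff R q (s + 1) f) : e 1 - e' 1 ≤ f 0 := by
  have hqJ : q ≤ colonIdeal R q := fun x hx r _ => q.mul_mem_left r hx
  generalize colonIdeal R q = J at *
  have hpow : ∀ n, maximalIdeal R * J ^ (n + 1) ≤ maximalIdeal R * q ^ (n + 1) := by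
    intro n
    induction n with
    | zero => simpa using h
    | succ n ih =>
      calc maximalIdeal R * J ^ (n + 1 + 1) = (maximalIdeal R * J) * J ^ (n + 1) := by ring
        _ ≤ (maximalIdeal R * q) * J ^ (n + 1) := Ideal.mul_mono_left h
        _ = q * (maximalIdeal R * J ^ (n + 1)) := by ring
        _ ≤ q * (maximalIdeal R * q ^ (n + 1)) := Ideal.mul_mono_right ih
        _ = _ := by ring
  have hcol : ∀ n, J ^ (n + 1) ≤ colonIdeal R (q ^ (n + 1)) := by
    intro n x hx r hr
    have h1 : r * x ∈ maximalIdeal R * q ^ (n + 1) := hpow n (Ideal.mul_mem_mul hr hx)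
    rw [smul_eq_mul]
    exact Ideal.mul_le_right h1
  obtain ⟨N₁, h₁⟩ := he.length_eq
  obtain ⟨N₂, h₂⟩ := he'.length_eq
  obtain ⟨N₃, h₃⟩ := hf.length_eq
  have key : ∀ n ≥ N₁ + N₂ + N₃,
      0 ≤ binomialSum (s + 1) e' n - binomialSum (s + 1) e n ∧
      binomialSum (s + 1) e' n - binomialSum (s + 1) e n ≤ binomialSum s f n := by
    intro n hn
    obtain ⟨a, ha, ha'⟩ := h₁ n (by omega)
    obtain ⟨b, hb, hb'⟩ := h₂ n (by omega)
    obtain ⟨c, hc, hc'⟩ := h₃ n (by omega)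
    have hadd := length_quotient_eq_add (Ideal.pow_right_mono hqJ (n + 1))
    have hle := Module.length_le_of_injective
      (Submodule.inclusion (Submodule.map_mono (f := (q ^ (n + 1)).mkQ) (hcol n)))
      (Submodule.inclusion_injective _)
    rw [hc] at hle
    rw [ha, hb] at hadd
    obtain ⟨k, hk⟩ := ENat.ne_top_iff_exists.mp (ne_top_of_le_ne_top (ENat.natCast_ne_top c) hle)
    rw [← hk] at hadd hle
    have hle' : k ≤ c := by exact_mod_cast hle
    have hadd' : b = k + a := by exact_mod_cast hadd
    rw [← ha', ← hb', ← hc', hadd']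
    clear * - hle'
    constructor <;> omega
  exact sub_le_of_binomialSum_sub_le (fun n hn => (key n hn).1) (fun n hn => (key n hn).2)

end Lengths

section Dimension

/-- If `s` generates an ideal of definition modulo `a`, then `dim B/a ≤ |s|`. -/
theorem ringKrullDim_quotient_le_card {B : Type*} [CommRing B] [IsLocalRing B]
    [IsNoetherianRing B] {a : Ideal B} (ha : a ≠ ⊤) (s : Finset B)
    (hs : ∀ x ∈ s, x ∈ maximalIdeal B)
    (h : maximalIdeal B ≤ (a ⊔ Ideal.span (s : Set B)).radical) :
    ringKrullDim (B ⧸ a) ≤ (s.card : WithBot ℕ∞) := by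
  classical
  have : Nontrivial (B ⧸ a) := Ideal.Quotient.nontrivial_iff.mpr ha
  have : IsLocalRing (B ⧸ a) :=
    IsLocalRing.of_surjective' (Ideal.Quotient.mk a) Ideal.Quotient.mk_surjective
  let t := s.image (Ideal.Quotient.mk a)
  have hmin : maximalIdeal (B ⧸ a) ∈ (Ideal.span (t : Set (B ⧸ a))).minimalPrimes := by
    have hcomap : (maximalIdeal (B ⧸ a)).comap (Ideal.Quotient.mk a) = maximalIdeal B :=
      IsLocalRing.eq_maximalIdeal
        (Ideal.comap_isMaximal_of_surjective _ Ideal.Quotient.mk_surjective)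
    refine ⟨⟨inferInstance, ?_⟩, ?_⟩
    · rw [Ideal.span_le]
      intro y hy
      obtain ⟨x, hx, rfl⟩ := Finset.mem_image.mp (Finset.mem_coe.mp hy)
      have := hs x hx
      rwa [← hcomap] at this
    · rintro Q ⟨hQ, htQ⟩ -
      have hle : maximalIdeal B ≤ Q.comap (Ideal.Quotient.mk a) := by
        refine h.trans ?_
        rw [(hQ.comap _).radical_le_iff, sup_le_iff, Ideal.span_le]
        constructor
        · intro x hx
          rw [Ideal.mem_comap, Ideal.Quotient.eq_zero_iff_mem.mpr hx]
          exact Q.zero_mem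
        · intro x hx
          exact htQ (Ideal.subset_span (Finset.mem_coe.mpr (Finset.mem_image_of_mem _ hx)))
      intro y hy
      obtain ⟨x, rfl⟩ := Ideal.Quotient.mk_surjective y
      exact hle (hcomap ▸ hy : x ∈ maximalIdeal B)
  rw [← IsLocalRing.maximalIdeal_height_eq_ringKrullDim]
  have := (Ideal.height_le_card_of_mem_minimalPrimes_span_finset hmin).trans
    (Nat.cast_le.mpr (Finset.card_image_le (s := s) (f := Ideal.Quotient.mk a)))
  exact_mod_cast this

end Dimension

section QuotientModules

variable {R : Type u} [CommRing R]

/-- The iterated quotient `(R / b) / a (R / b)` is `R / (b + a)`: membership form. -/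
theorem mk_mk_eq_zero_iff (a b : Ideal R) (r : R) :
    (Submodule.Quotient.mk (Submodule.Quotient.mk r : R ⧸ (b • (⊤ : Submodule R R))) :
      (R ⧸ (b • (⊤ : Submodule R R))) ⧸
        (a • (⊤ : Submodule R (R ⧸ (b • (⊤ : Submodule R R)))))) = 0 ↔ r ∈ b ⊔ a := by
  have h1 : (⊤ : Submodule R (R ⧸ (b • (⊤ : Submodule R R)))) =
      Submodule.map (b • (⊤ : Submodule R R)).mkQ ⊤ := by
    rw [Submodule.map_top, Submodule.range_mkQ]
  rw [Submodule.Quotient.mk_eq_zero, h1, ← Submodule.map_smul'']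
  rw [← Submodule.mkQ_apply, ← Submodule.mem_comap, Submodule.comap_map_eq, Submodule.ker_mkQ]
  simp only [smul_eq_mul, Ideal.mul_top]
  rw [sup_comm]

theorem annihilator_quotient_smul_top (b : Ideal R) :
    Module.annihilator R (R ⧸ (b • (⊤ : Submodule R R))) = b := by
  rw [smul_eq_mul, Ideal.mul_top, Ideal.annihilator_quotient]

theorem moduleDim_self : moduleDim R R = ringKrullDim R := by
  rw [moduleDim, Module.annihilator_eq_bot.mpr inferInstance]
  exact ringKrullDim_eq_of_ringEquiv (RingEquiv.quotientBot R)

/-- A criterion for a system of parameters of `R / b`. -/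
theorem isSOP_quotient {b : Ideal R} {s : ℕ} {y : Fin s → R}
    (hdim : ringKrullDim (R ⧸ b) = (s : WithBot ℕ∞)) (hy : ∀ i, y i ∈ nonunits R)
    (hfin : IsFiniteLength R (R ⧸ (b ⊔ Ideal.span (Set.range y)))) :
    IsSOP R (R ⧸ (b • (⊤ : Submodule R R))) y := by
  refine ⟨by rw [moduleDim, annihilator_quotient_smul_top, hdim], hy, ?_⟩
  let φ : R →ₗ[R] (R ⧸ (b • (⊤ : Submodule R R))) ⧸
      (Ideal.span (Set.range y) • (⊤ : Submodule R (R ⧸ (b • (⊤ : Submodule R R))))) :=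
    (Submodule.mkQ _).comp (Submodule.mkQ _)
  have hφ : Function.Surjective φ :=
    (Submodule.mkQ_surjective _).comp (Submodule.mkQ_surjective _)
  have hker : b ⊔ Ideal.span (Set.range y) ≤ LinearMap.ker φ := fun r hr =>
    (mk_mk_eq_zero_iff _ _ r).mpr hr
  exact hfin.of_surjective (f := Submodule.liftQ _ φ hker) fun w => by
    obtain ⟨r, rfl⟩ := hφ w
    exact ⟨Submodule.Quotient.mk r, rfl⟩

/-- Elements of `b(R / b)` multiply colon ideals of partial systems of parameters into the
partial parameter ideals. -/
theorem mul_mem_of_mem_bIdeal {b : Ideal R} {s : ℕ} {y : Fin s → R}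
    (hy : IsSOP R (R ⧸ (b • (⊤ : Submodule R R))) y) (i : Fin s) {c v : R}
    (hc : c ∈ bIdeal R (R ⧸ (b • (⊤ : Submodule R R))))
    (hv : v * y i ∈ b ⊔ Ideal.span (y '' {j | j < i})) :
    c * v ∈ b ⊔ Ideal.span (y '' {j | j < i}) := by
  simp only [bIdeal, Submodule.mem_iInf] at hc
  have h := hc s y hy i
  rw [Submodule.mem_annihilator] at h
  have h1 := h (Submodule.Quotient.mk (Submodule.Quotient.mk v)) (by
    rw [Submodule.mem_torsionBy_iff, ← Submodule.Quotient.mk_smul, ← Submodule.Quotient.mk_smul,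
      mk_mk_eq_zero_iff, smul_eq_mul, mul_comm]
    exact hv)
  rwa [← Submodule.Quotient.mk_smul, ← Submodule.Quotient.mk_smul, mk_mk_eq_zero_iff,
    smul_eq_mul] at h1

/-- If `R / q` has finite length, then the maximal ideal is contained in the radical of `q`. -/
theorem maximalIdeal_le_radical_of_isFiniteLength [IsLocalRing R] {q : Ideal R}
    (h : IsFiniteLength R (R ⧸ q)) : maximalIdeal R ≤ q.radical := by
  obtain ⟨-, hA⟩ := isFiniteLength_iff_isNoetherian_isArtinian.mp h
  have hAR : IsArtinianRing (R ⧸ q) := isArtinian_of_tower R hA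
  rw [Ideal.radical_eq_sInf]
  refine le_sInf fun p ⟨hqp, hp⟩ => ?_
  have : IsArtinianRing (R ⧸ p) :=
    (Ideal.Quotient.factor_surjective hqp).isArtinianRing
  have hmax : p.IsMaximal :=
    Ideal.Quotient.maximal_of_isField _ (IsArtinianRing.isField_of_isDomain _)
  exact (IsLocalRing.eq_maximalIdeal hmax).ge

end QuotientModules

section CompleteNoetherian

theorem MvPolynomial.homogeneousComponent_mul_of_isHomogeneous {σ R : Type*} [CommRing R]
    (H G : MvPolynomial σ R) {k : ℕ} (hG : G.IsHomogeneous k) (n : ℕ) :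
    MvPolynomial.homogeneousComponent n (H * G) =
      if k ≤ n then MvPolynomial.homogeneousComponent (n - k) H * G else 0 := by
  classical
  let _ := MvPolynomial.gradedAlgebra (σ := σ) (R := R)
  have h := DirectSum.coe_decompose_mul_of_right_mem
    (𝒜 := MvPolynomial.homogeneousSubmodule σ R) (a := H) n
    ((MvPolynomial.mem_homogeneousSubmodule k G).mpr hG)
  have h2 : ∀ (p : MvPolynomial σ R) (i : ℕ),
      ((DirectSum.decompose (MvPolynomial.homogeneousSubmodule σ R) p) i : MvPolynomial σ R) =
        MvPolynomial.homogeneousComponent i p :=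
    fun p i => MvPolynomial.decomposition.decompose'_apply p i
  rwa [h2, h2] at h

variable {R A : Type*} [CommRing R] [CommRing A] [Algebra R A]

theorem MvPolynomial.IsHomogeneous.aeval_mem_span_pow {ι : Type*} {G : MvPolynomial ι R} {n : ℕ}
    (hG : G.IsHomogeneous n) (t : ι → A) :
    MvPolynomial.aeval t G ∈ Ideal.span (Set.range t) ^ n := by
  rw [Ideal.mem_span_pow_iff_exists_isHomogeneous]
  exact ⟨MvPolynomial.map (algebraMap R A) G, hG.map _, by
    rw [MvPolynomial.eval_map, MvPolynomial.aeval_def]⟩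

/-- Leading forms with coefficients in a ring that surjects onto the residue ring. -/
theorem exists_isHomogeneous_sub_aeval_mem {ι : Type*} (t : ι → A)
    (hsurj : ∀ x : A, ∃ r : R, x - algebraMap R A r ∈ Ideal.span (Set.range t)) {n : ℕ} {f : A}
    (hf : f ∈ Ideal.span (Set.range t) ^ n) :
    ∃ F : MvPolynomial ι R, F.IsHomogeneous n ∧
      f - MvPolynomial.aeval t F ∈ Ideal.span (Set.range t) ^ (n + 1) := by
  obtain ⟨p, hp, rfl⟩ := (Ideal.mem_span_pow_iff_exists_isHomogeneous t f).mp hf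
  choose σ hσ using hsurj
  have hdeg : ∀ α ∈ p.support, α.degree = n := fun α hα =>
    (Finsupp.degree_eq_weight_one (R := ℕ) ▸ hp (MvPolynomial.mem_support_iff.mp hα))
  refine ⟨∑ α ∈ p.support, MvPolynomial.monomial α (σ (p.coeff α)),
    MvPolynomial.IsHomogeneous.sum _ _ _ fun α hα =>
      MvPolynomial.isHomogeneous_monomial _ (hdeg α hα), ?_⟩
  rw [map_sum, MvPolynomial.eval_eq, ← Finset.sum_sub_distrib]
  refine Ideal.sum_mem _ fun α hα => ?_
  rw [MvPolynomial.aeval_monomial, Finsupp.prod, ← sub_mul, pow_succ']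
  refine Ideal.mul_mem_mul (hσ _) ?_
  rw [← hdeg α hα, Finsupp.degree_apply, ← Finset.prod_pow_eq_pow_sum]
  exact Ideal.prod_mem_prod fun i _ =>
    Ideal.pow_mem_pow (Ideal.subset_span (Set.mem_range_self i)) _

/-- A ring which is complete with respect to a finitely generated ideal and whose residue ring is
an image of a Noetherian ring is Noetherian. -/
theorem isNoetherianRing_of_isAdicComplete [IsNoetherianRing R] {ι : Type*} [Finite ι]
    (t : ι → A) [IsAdicComplete (Ideal.span (Set.range t)) A]
    (hsurj : ∀ x : A, ∃ r : R, x - algebraMap R A r ∈ Ideal.span (Set.range t)) :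
    IsNoetherianRing A := by
  classical
  set a := Ideal.span (Set.range t) with ha
  rw [isNoetherianRing_iff_ideal_fg]
  intro I
  let L : Set (MvPolynomial ι R) :=
    {F | ∃ n, F.IsHomogeneous n ∧ ∃ g ∈ I, g - MvPolynomial.aeval t F ∈ a ^ (n + 1)}
  obtain ⟨s, hsL, hs⟩ := (Submodule.fg_span_iff_fg_span_finset_subset L).mp
    ((isNoetherianRing_iff_ideal_fg _).mp inferInstance (Ideal.span L))
  have hsL' : ∀ F ∈ s, ∃ n, F.IsHomogeneous n ∧
      ∃ g ∈ I, g - MvPolynomial.aeval t F ∈ a ^ (n + 1) := fun F hF => hsL hF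
  choose! deg hdeg g hgI hg using hsL'
  have step : ∀ (n : ℕ) (f : A), ∃ c : MvPolynomial ι R → A, f ∈ I → f ∈ a ^ n →
      (∀ F ∈ s, c F ∈ a ^ (n - deg F)) ∧ f - ∑ F ∈ s, c F * g F ∈ a ^ (n + 1) := by
    intro n f
    by_cases hf : f ∈ I ∧ f ∈ a ^ n
    swap
    · exact ⟨0, fun h1 h2 => absurd ⟨h1, h2⟩ hf⟩
    obtain ⟨G, hG, hfG⟩ := exists_isHomogeneous_sub_aeval_mem t hsurj hf.2
    have hGL : G ∈ Ideal.span (s : Set (MvPolynomial ι R)) := by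
      have : G ∈ Ideal.span L := Ideal.subset_span ⟨n, hG, f, hf.1, hfG⟩
      rwa [Ideal.span, hs] at this
    obtain ⟨H, hH⟩ := Submodule.mem_span_finset.mp hGL
    have hGsum : G = ∑ F ∈ s, if deg F ≤ n then
        MvPolynomial.homogeneousComponent (n - deg F) (H F) * F else 0 := by
      have h1 := MvPolynomial.homogeneousComponent_eq_self hG
      rw [← hH.2, map_sum] at h1
      rw [← hH.2, ← h1]
      refine Finset.sum_congr rfl fun F hF => ?_
      rw [smul_eq_mul, MvPolynomial.homogeneousComponent_mul_of_isHomogeneous _ _ (hdeg F hF)]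
    refine ⟨fun F => if deg F ≤ n then
      MvPolynomial.aeval t (MvPolynomial.homogeneousComponent (n - deg F) (H F)) else 0,
      fun _ _ => ⟨fun F hF => ?_, ?_⟩⟩
    · dsimp only
      split_ifs with h
      · exact (MvPolynomial.homogeneousComponent_isHomogeneous _ _).aeval_mem_span_pow t
      · exact Ideal.zero_mem _
    · have h2 : ∀ c : MvPolynomial ι R → A, f - ∑ F ∈ s, c F * g F =
          (f - MvPolynomial.aeval t G) -
            ∑ F ∈ s, c F * (g F - MvPolynomial.aeval t F) +
          (MvPolynomial.aeval t G - ∑ F ∈ s, c F * MvPolynomial.aeval t F) := by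
        intro c
        simp only [mul_sub, Finset.sum_sub_distrib]
        ring
      rw [h2]
      refine Ideal.add_mem _ (Ideal.sub_mem _ hfG (Ideal.sum_mem _ fun F hF => ?_)) ?_
      · split_ifs with h
        · have h3 := Ideal.mul_mem_mul ((MvPolynomial.homogeneousComponent_isHomogeneous
            (n - deg F) (H F)).aeval_mem_span_pow t) (hg F hF)
          rw [← ha, ← pow_add] at h3
          rwa [show n - deg F + (deg F + 1) = n + 1 by omega] at h3
        · rw [zero_mul]; exact Ideal.zero_mem _
      · convert Ideal.zero_mem _ using 1
        conv_lhs => rw [hGsum]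
        rw [map_sum, sub_eq_zero]
        refine Finset.sum_congr rfl fun F hF => ?_
        split_ifs <;> simp
  choose c hc using step
  refine ⟨s.image g, le_antisymm (Submodule.span_le.mpr ?_) fun f hf => ?_⟩
  · intro x hx
    obtain ⟨F, hF, rfl⟩ := Finset.mem_image.mp (Finset.mem_coe.mp hx)
    exact hgI F hF
  let φ : ℕ → A := fun n => Nat.rec f (fun n y => y - ∑ F ∈ s, c n y F * g F) n
  have hφs : ∀ n, φ (n + 1) = φ n - ∑ F ∈ s, c n (φ n) F * g F := fun n => rfl
  have hφ : ∀ n, φ n ∈ I ∧ φ n ∈ a ^ n := by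
    intro n
    induction n with
    | zero => exact ⟨hf, by simp⟩
    | succ n ih =>
      refine ⟨?_, ?_⟩
      · rw [hφs]
        exact I.sub_mem ih.1 (I.sum_mem fun F hF => I.mul_mem_left _ (hgI F hF))
      · rw [hφs]
        exact (hc n _ ih.1 ih.2).2
  let S : MvPolynomial ι R → ℕ → A := fun F k => ∑ n ∈ Finset.range k, c n (φ n) F
  have hφS : ∀ k, φ k = f - ∑ F ∈ s, S F k * g F := by
    intro k
    induction k with
    | zero => simp [S, φ]
    | succ k ih =>
      simp only [S, Finset.sum_range_succ, add_mul, Finset.sum_add_distrib] at ih ⊢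
      rw [hφs]
      linear_combination ih
  let D := s.sup deg
  have hcauchy : ∀ F ∈ s, ∀ m n, m ≤ n → S F (n + D) - S F (m + D) ∈ a ^ m := by
    intro F hF m n hmn
    rw [← Finset.sum_Ico_eq_sub _ (by omega)]
    refine Ideal.sum_mem _ fun k hk => ?_
    have hk' := Finset.mem_Ico.mp hk
    have hD : deg F ≤ D := Finset.le_sup hF
    exact Ideal.pow_le_pow_right (by omega) ((hc k _ (hφ k).1 (hφ k).2).1 F hF)
  have hlim : ∀ F, ∃ l : A, F ∈ s → ∀ n, l - S F (n + D) ∈ a ^ n := by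
    intro F
    by_cases hF : F ∈ s
    swap
    · exact ⟨0, fun h => absurd h hF⟩
    obtain ⟨l, hl⟩ := IsPrecomplete.prec (I := a) (M := A) inferInstance
      (f := fun n => S F (n + D)) (fun {m n} hmn => by
        rw [SModEq.comm, SModEq.sub_mem, smul_eq_mul, Ideal.mul_top]
        exact hcauchy F hF m n hmn)
    refine ⟨l, fun _ n => ?_⟩
    have := hl n
    rwa [SModEq.comm, SModEq.sub_mem, smul_eq_mul, Ideal.mul_top] at this
  choose l hl using hlim
  have hf_eq : f = ∑ F ∈ s, l F * g F := by
    rw [← sub_eq_zero]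
    refine IsHausdorff.haus (I := a) (M := A) inferInstance _ fun n => ?_
    rw [SModEq.zero, smul_eq_mul, Ideal.mul_top]
    have h1 : f - ∑ F ∈ s, l F * g F =
        φ (n + D) - ∑ F ∈ s, (l F - S F (n + D)) * g F := by
      rw [hφS]
      simp only [sub_mul, Finset.sum_sub_distrib]
      ring
    rw [h1]
    exact Ideal.sub_mem _ (Ideal.pow_le_pow_right (by omega) (hφ (n + D)).2)
      (Ideal.sum_mem _ fun F hF => Ideal.mul_mem_right _ _ (hl F hF n))
  rw [hf_eq]
  exact Submodule.sum_mem _ fun F hF => Submodule.smul_mem _ _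
    (Submodule.subset_span (Finset.mem_coe.mpr (Finset.mem_image_of_mem _ hF)))

end CompleteNoetherian

section Unmixed

variable (R : Type u) [CommRing R] [IsLocalRing R] [IsNoetherianRing R]

theorem isNoetherianRing_adicCompletion_maximalIdeal :
    IsNoetherianRing (AdicCompletion (maximalIdeal R) R) := by
  obtain ⟨s, hs⟩ := (isNoetherianRing_iff_ideal_fg R).mp inferInstance (maximalIdeal R)
  let t : s → AdicCompletion (maximalIdeal R) R := fun i => algebraMap R _ (i : R)
  have ht : Ideal.span (Set.range t) =
      (maximalIdeal R).map (algebraMap R (AdicCompletion (maximalIdeal R) R)) := by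
    have h := Ideal.map_span (algebraMap R (AdicCompletion (maximalIdeal R) R)) (s : Set R)
    rw [hs] at h
    rw [h]
    congr 1
    ext y
    simp [t]
  have hc : IsAdicComplete (Ideal.span (Set.range t)) (AdicCompletion (maximalIdeal R) R) := by
    rw [ht]
    exact AdicCompletion.isAdicComplete_self _ ⟨s, hs⟩
  refine isNoetherianRing_of_isAdicComplete (R := R) t fun x => ?_
  rw [ht, ← AdicCompletion.ker_evalOneₐ_eq_map _ ⟨s, hs⟩]
  obtain ⟨r, hr⟩ := Ideal.Quotient.mk_surjective (AdicCompletion.evalOneₐ (maximalIdeal R) x)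
  refine ⟨r, ?_⟩
  rw [RingHom.mem_ker]
  change AdicCompletion.evalOneₐ (maximalIdeal R) _ = 0
  rw [map_sub, AlgHom.commutes, ← hr]
  exact sub_self _

theorem ringKrullDim_le_adicCompletion :
    ringKrullDim R ≤ ringKrullDim (AdicCompletion (maximalIdeal R) R) := by
  have := isNoetherianRing_adicCompletion_maximalIdeal R
  have hlo : (maximalIdeal (AdicCompletion (maximalIdeal R) R)).LiesOver (maximalIdeal R) :=
    ⟨(IsLocalRing.maximalIdeal_comap (algebraMap R (AdicCompletion (maximalIdeal R) R))).symm⟩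
  have : Algebra.HasGoingDown R (AdicCompletion (maximalIdeal R) R) := Algebra.HasGoingDown.of_flat
  rw [← IsLocalRing.maximalIdeal_height_eq_ringKrullDim,
    ← IsLocalRing.maximalIdeal_height_eq_ringKrullDim,
    Ideal.height_eq_height_add_of_liesOver_of_hasGoingDown (maximalIdeal R)
      (maximalIdeal (AdicCompletion (maximalIdeal R) R))]
  exact_mod_cast le_self_add

variable {R}

/-- In an unmixed local ring every element of a system of parameters is a nonzerodivisor. -/
theorem IsUnmixedRing.eq_zero_of_mul_eq_zero (hum : IsUnmixedRing R) {l : ℕ}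
    (hdim : (l : WithBot ℕ∞) < ringKrullDim R) (s : Finset R) (hs : ∀ x ∈ s, x ∈ maximalIdeal R)
    (hsc : s.card ≤ l) {x : R}
    (hrad : maximalIdeal R ≤ (Ideal.span {x} ⊔ Ideal.span (s : Set R)).radical) {u : R}
    (hu : u * x = 0) : u = 0 := by
  classical
  by_contra hu0
  have := isNoetherianRing_adicCompletion_maximalIdeal R
  let φ := algebraMap R (AdicCompletion (maximalIdeal R) R)
  have hφ : Function.Injective φ := AdicCompletion.of_injective (maximalIdeal R) R
  have hmem : φ x ∈ ⋃ p ∈ associatedPrimes (AdicCompletion (maximalIdeal R) R)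
      (AdicCompletion (maximalIdeal R) R), (p : Set (AdicCompletion (maximalIdeal R) R)) := by
    rw [biUnion_associatedPrimes_eq_zero_divisors]
    refine ⟨φ u, (map_ne_zero_iff φ hφ).mpr hu0, ?_⟩
    rw [smul_eq_mul, ← map_mul, mul_comm, hu, map_zero]
  simp only [Set.mem_iUnion] at hmem
  obtain ⟨P, hP, hxP⟩ := hmem
  have hP' : P.IsPrime := hP.isPrime
  have hle : ringKrullDim (AdicCompletion (maximalIdeal R) R ⧸ P) ≤
      ((s.image φ).card : WithBot ℕ∞) := by
    refine ringKrullDim_quotient_le_card hP'.ne_top _ ?_ ?_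
    · intro y hy
      obtain ⟨x, hx, rfl⟩ := Finset.mem_image.mp hy
      rw [AdicCompletion.maximalIdeal_eq_map]
      exact Ideal.mem_map_of_mem _ (hs x hx)
    · rw [AdicCompletion.maximalIdeal_eq_map]
      refine (Ideal.map_mono hrad).trans ((Ideal.map_radical_le _).trans ?_)
      refine Ideal.radical_mono ?_
      rw [Ideal.map_sup, Ideal.map_span, Ideal.map_span, Set.image_singleton, Finset.coe_image]
      exact sup_le_sup_right ((Ideal.span_singleton_le_iff_mem _).mpr hxP) _
  rw [hum P hP] at hle
  have h1 : ((s.image φ).card : WithBot ℕ∞) ≤ l :=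
    Nat.cast_le.mpr (Finset.card_image_le.trans hsc)
  exact absurd (hdim.trans_le (ringKrullDim_le_adicCompletion R)) (not_lt.mpr (hle.trans h1))

end Unmixed

section PrincipalModulo

variable {R : Type*} [CommRing R] [IsLocalRing R] [IsNoetherianRing R]

/-- If `b` is contained in `(a ^ v) + U` for all `v`, where `a` lies in the maximal ideal,
then it is contained in `U`, by Krull's intersection theorem. -/
theorem le_of_forall_le_span_pow_sup {b U : Ideal R} {a : R} (ha : a ∈ maximalIdeal R)
    (h : ∀ v : ℕ, b ≤ Ideal.span {a ^ v} ⊔ U) : b ≤ U := by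
  intro x hx
  rw [← Ideal.Quotient.eq_zero_iff_mem]
  refine IsHausdorff.haus (I := maximalIdeal R) (M := R ⧸ U) inferInstance _ fun n => ?_
  rw [SModEq.zero]
  obtain ⟨r, u, hu, rfl⟩ := Ideal.mem_span_singleton_sup.mp (h n hx)
  have : Ideal.Quotient.mk U (r * a ^ n + u) = (a ^ n) • Ideal.Quotient.mk U r := by
    rw [map_add, Ideal.Quotient.eq_zero_iff_mem.mpr hu, add_zero, Algebra.smul_def, mul_comm,
      map_mul]
    rfl
  rw [this]
  exact Submodule.smul_mem_smul (Ideal.pow_mem_pow ha n) trivial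

/-- If the maximal ideal is principal modulo `U`, then every ideal is principal modulo `U`. -/
theorem exists_mem_le_span_singleton_sup {b U : Ideal R} {a : R} (ha : a ∈ maximalIdeal R)
    (hm : maximalIdeal R ≤ Ideal.span {a} ⊔ U) (hbU : ¬ b ≤ U) :
    ∃ (c : R) (v : ℕ), c ∈ b ∧ b ≤ Ideal.span {c} ⊔ U ∧ b ≤ Ideal.span {a ^ v} ⊔ U ∧
      ∃ r, IsUnit r ∧ c - r * a ^ v ∈ U := by
  classical
  have hex : ∃ v, ¬ b ≤ Ideal.span {a ^ v} ⊔ U := by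
    by_contra! h
    exact hbU (le_of_forall_le_span_pow_sup ha h)
  obtain ⟨v, hv⟩ : ∃ v, Nat.find hex = v + 1 := Nat.exists_eq_succ_of_ne_zero fun h0 => by
    have := Nat.find_spec hex
    rw [h0] at this
    exact this (by simp)
  have h1 : b ≤ Ideal.span {a ^ v} ⊔ U := by
    have := Nat.find_min hex (m := v) (by omega)
    exact not_not.mp this
  have h2 := Nat.find_spec hex
  rw [hv] at h2
  obtain ⟨c, hc, hc'⟩ := SetLike.not_le_iff_exists.mp h2
  obtain ⟨r, u, hu, hru⟩ := Ideal.mem_span_singleton_sup.mp (h1 hc)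
  have hr : IsUnit r := by
    by_contra hr
    obtain ⟨s, u', hu', rfl⟩ := Ideal.mem_span_singleton_sup.mp
      (hm ((IsLocalRing.mem_maximalIdeal r).mpr hr))
    refine hc' (Ideal.mem_span_singleton_sup.mpr
      ⟨s, u' * a ^ v + u, U.add_mem (U.mul_mem_right _ hu') hu, ?_⟩)
    rw [← hru]; ring
  refine ⟨c, v, hc, h1.trans (sup_le ?_ le_sup_right), h1, r, hr, ?_⟩
  · rw [Ideal.span_singleton_le_iff_mem, Ideal.mem_span_singleton_sup]
    obtain ⟨s, hs⟩ := hr.exists_left_inv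
    refine ⟨s, - (s * u), U.neg_mem (U.mul_mem_left _ hu), ?_⟩
    rw [← hru]
    linear_combination a ^ v * hs
  · rw [← hru, add_sub_cancel_left]; exact hu

end PrincipalModulo

section WeightContradiction

variable {R : Type*} [CommRing R] {d : ℕ}

theorem prod_pow_single (z : Fin d → R) (i : Fin d) (n : ℕ) :
    ∏ k, z k ^ (Pi.single i n : Fin d → ℕ) k = z i ^ n := by
  simp [Pi.single_apply, pow_ite]

theorem mem_maximalIdeal_radical_update [IsLocalRing R] {x : Fin d → R} {i : Fin d} {c : R}
    (hrad : maximalIdeal R ≤ (Ideal.span (Set.range x)).radical)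
    (hxi : x i ∈ Ideal.span {c} ⊔ (Ideal.span (x '' {j | j ≠ i})).colon {x i}) :
    maximalIdeal R ≤ (Ideal.span (Set.range (Function.update x i c))).radical := by
  have hc : c ∈ Ideal.span (Set.range (Function.update x i c)) :=
    Ideal.subset_span ⟨i, by simp⟩
  have hj : ∀ j ≠ i, x j ∈ Ideal.span (Set.range (Function.update x i c)) := fun j hj =>
    Ideal.subset_span ⟨j, by simp [hj]⟩
  refine hrad.trans ?_
  rw [Ideal.radical_le_radical_iff, Ideal.span_le]
  rintro _ ⟨j, rfl⟩
  by_cases hji : j = i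
  · subst hji
    obtain ⟨r, u, hu, h⟩ := Ideal.mem_span_singleton_sup.mp hxi
    refine ⟨2, ?_⟩
    have h1 : x j ^ 2 = (r * x j) * c + u * x j := by linear_combination (-x j) * h
    rw [h1]
    refine Ideal.add_mem _ (Ideal.mul_mem_left _ _ hc) ?_
    refine Ideal.span_le.mpr ?_ (Submodule.mem_colon_singleton.mp hu)
    rintro _ ⟨k, hk, rfl⟩
    exact hj k hk
  · exact Ideal.le_radical (hj j hji)

variable [IsLocalRing R] [IsNoetherianRing R]

/-- A member of a system of parameters is not in the ideal `((x_j : j ≠ i) : x_i)`. -/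
theorem notMem_colon_singleton_self (hd : (d : WithBot ℕ∞) ≤ ringKrullDim R) {x : Fin d → R}
    (hx : ∀ i, x i ∈ maximalIdeal R)
    (hrad : maximalIdeal R ≤ (Ideal.span (Set.range x)).radical) (i : Fin d) :
    x i ∉ (Ideal.span (x '' {j | j ≠ i})).colon {x i} := by
  classical
  intro h
  rw [Submodule.mem_colon_singleton, smul_eq_mul] at h
  let w : Fin d → ℕ := fun j => if j = i then 1 else 3
  have hsum : ∑ k, w k * (Pi.single i 2 : Fin d → ℕ) k = 2 := by simp [w, Pi.single_apply]
  refine prod_pow_notMem_weightIdeal hd x hx hrad w (fun j => by simp only [w]; split_ifs <;> omega)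
    (Pi.single i 2) ?_
  rw [hsum]
  rw [prod_pow_single, sq]
  refine Ideal.span_le.mpr ?_ h
  rintro _ ⟨k, hk, rfl⟩
  have := mem_weightIdeal_single x w k 1
  simpa [w, show k ≠ i from hk] using this

theorem false_of_mul_mem_weightIdeal (hd : (d : WithBot ℕ∞) ≤ ringKrullDim R) {z : Fin d → R}
    (hz : ∀ i, z i ∈ maximalIdeal R)
    (hrad : maximalIdeal R ≤ (Ideal.span (Set.range z)).radical) {w : Fin d → ℕ}
    (hw : ∀ i, 0 < w i) {i j : Fin d} (hwi : w i = 1) (hwj : w j = 2) {b : Ideal R}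
    {N : ℕ} (hb : ∀ v ∈ b, z i ^ N * v ∈ weightIdeal z w (N + 1)) (hj : z j ∈ b ^ 3) : False := by
  classical
  have h1 : Ideal.span {z i ^ N} * b ≤ weightIdeal z w (N + 1) :=
    Ideal.span_singleton_mul_le_iff.mpr hb
  let α : Fin d → ℕ := Pi.single i (3 * N) + Pi.single j 1
  have hα : ∑ k, w k * α k = 3 * N + 2 := by
    simp [α, mul_add, Finset.sum_add_distrib, Pi.single_apply, hwi, hwj]
  have hp : ∏ k, z k ^ α k = (z i ^ N) ^ 3 * z j := by
    simp only [α, Pi.add_apply, pow_add, Finset.prod_mul_distrib, prod_pow_single]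
    ring
  refine prod_pow_notMem_weightIdeal hd z hz hrad w hw α ?_
  rw [hα, hp]
  have h2 : (z i ^ N) ^ 3 * z j ∈ (Ideal.span {z i ^ N} * b) ^ 3 := by
    rw [mul_pow]
    exact Ideal.mul_mem_mul (Ideal.pow_mem_pow (Ideal.mem_span_singleton_self _) 3) hj
  have h3 := Ideal.pow_right_mono h1 3 h2
  have h4 : weightIdeal z w (N + 1) ^ 3 ≤ weightIdeal z w ((N + 1) + (N + 1) + (N + 1)) := by
    rw [pow_succ, pow_two]
    exact (Ideal.mul_mono_left (weightIdeal_mul_le z w _ _)).trans (weightIdeal_mul_le z w _ _)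
  exact weightIdeal_anti z w (by omega) (h4 h3)

theorem false_of_forall_mul_mem_weightIdeal (hd : (d : WithBot ℕ∞) ≤ ringKrullDim R)
    {x : Fin d → R} (hx : ∀ i, x i ∈ maximalIdeal R)
    (hrad : maximalIdeal R ≤ (Ideal.span (Set.range x)).radical) {i j : Fin d} (hij : j ≠ i)
    {a : R} (ha : a ∈ maximalIdeal R)
    (hm : maximalIdeal R ≤ Ideal.span {a} ⊔ (Ideal.span (x '' {j | j ≠ i})).colon {x i})
    {w : Fin d → ℕ} (hw : ∀ i, 0 < w i) (hwi : w i = 1) (hwj : w j = 2) {b : Ideal R}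
    (hb : b ≠ ⊤) (hxi : x i ∈ b) (hxj : x j ∈ b ^ 3) {N : ℕ}
    (hN : ∀ c ∈ b, b ≤ Ideal.span {c} ⊔ (Ideal.span (x '' {j | j ≠ i})).colon {x i} →
      ∀ v ∈ b, c ^ N * v ∈ weightIdeal (Function.update x i c) w (N + 1)) : False := by
  obtain ⟨c, -, hcb, hbc, -⟩ := exists_mem_le_span_singleton_sup ha hm
    (fun h => notMem_colon_singleton_self hd hx hrad i (h hxi))
  refine false_of_mul_mem_weightIdeal hd (z := Function.update x i c) ?_
    (mem_maximalIdeal_radical_update hrad (hbc hxi)) hw hwi hwj (b := b) (N := N) ?_ ?_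
  · intro k
    by_cases hk : k = i
    · subst hk; simpa using (le_maximalIdeal hb) hcb
    · simpa [hk] using hx k
  · simpa using hN c hcb hbc
  · simpa [hij] using hxj

end WeightContradiction

section CSystem

variable {R : Type u} [CommRing R] {l : ℕ}

theorem IsSOP.mem_maximalIdeal [IsLocalRing R] {M : Type u} [AddCommGroup M] [Module R M]
    {s : ℕ} {x : Fin s → R}
    (hx : IsSOP R M x) (i : Fin s) : x i ∈ maximalIdeal R :=
  (IsLocalRing.mem_maximalIdeal _).mpr (hx.2.1 i)

theorem IsSOP.isFiniteLength_quotient {s : ℕ} {x : Fin s → R} (hx : IsSOP R R x) :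
    IsFiniteLength R (R ⧸ Ideal.span (Set.range x)) := by
  have := hx.2.2
  rwa [smul_eq_mul, Ideal.mul_top] at this

theorem IsSOP.maximalIdeal_le_radical [IsLocalRing R] {s : ℕ} {x : Fin s → R} (hx : IsSOP R R x) :
    maximalIdeal R ≤ (Ideal.span (Set.range x)).radical :=
  maximalIdeal_le_radical_of_isFiniteLength hx.isFiniteLength_quotient

theorem IsSOP.ringKrullDim_eq {s : ℕ} {x : Fin s → R} (hx : IsSOP R R x) :
    ringKrullDim R = (s : WithBot ℕ∞) := by
  rw [← hx.1, moduleDim_self]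

theorem pow_mul_mem_of_mul_mem_span {x : Fin (l + 1) → R}
    (hnzd : ∀ u, u * x (Fin.last l) = 0 → u = 0) {c : R}
    (hc : ∀ k, k ≠ Fin.last l → ∀ v, v * x k ∈
      Ideal.span {x (Fin.last l)} ⊔ Ideal.span (x '' {j | j < k}) →
      c * v ∈ Ideal.span {x (Fin.last l)} ⊔ Ideal.span (x '' {j | j < k}))
    {K : Ideal R} (hK : ∀ k : Fin (l + 1), k ≠ Fin.last l → c ^ (k : ℕ) * x k ∈ K) {v : R}
    (hv : v * x (Fin.last l) ∈ Ideal.span (x '' {j | j < Fin.last l})) : c ^ l * v ∈ K := by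
  have key : ∀ k : Fin (l + 1), ∀ v, v * x (Fin.last l) ∈ Ideal.span (x '' {j | j < k}) →
      c ^ (k : ℕ) * v ∈ K := by
    intro k
    induction k using Fin.induction with
    | zero =>
      intro v hv
      have : v = 0 := hnzd v (by simpa using hv)
      rw [this, mul_zero]
      exact K.zero_mem
    | succ k ih =>
      intro v hv
      have hk : k.castSucc ≠ Fin.last l := (Fin.castSucc_lt_last k).ne
      have hset : {j : Fin (l + 1) | j < k.succ} = insert k.castSucc {j | j < k.castSucc} := by
        ext j
        simp only [Set.mem_ofPred_eq, Set.mem_insert_iff, Fin.lt_def, Fin.ext_iff, Fin.val_succ,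
          Fin.val_castSucc]
        omega
      rw [hset, Set.image_insert_eq, Ideal.span_insert, Ideal.mem_span_singleton_sup] at hv
      obtain ⟨r, p, hp, hrp⟩ := hv
      have h1 : r * x k.castSucc ∈
          Ideal.span {x (Fin.last l)} ⊔ Ideal.span (x '' {j | j < k.castSucc}) :=
        Ideal.mem_span_singleton_sup.mpr ⟨v, -p, neg_mem hp, by rw [← hrp]; ring⟩
      obtain ⟨s, t, ht, hst⟩ := Ideal.mem_span_singleton_sup.mp (hc _ hk r h1)
      have h2 := ih (c * v - s * x k.castSucc) (by
        have : (c * v - s * x k.castSucc) * x (Fin.last l) = t * x k.castSucc + c * p := by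
          linear_combination (-c) * hrp - x k.castSucc * hst
        rw [this]
        exact Ideal.add_mem _ (Ideal.mul_mem_right _ _ ht) (Ideal.mul_mem_left _ _ hp))
      have h3 := Ideal.add_mem _ h2 (Ideal.mul_mem_left K s (hK _ hk))
      simp only [Fin.val_castSucc, Fin.val_succ] at h3 ⊢
      convert h3 using 1
      ring
  exact key (Fin.last l) v hv

variable [IsLocalRing R] [IsNoetherianRing R]

/-- The colon ideals of a C-system of parameters at an index other than the last one. -/
theorem IsCSOP.colon_le_of_ne_last {x : Fin (l + 1) → R} (hx : IsCSOP R R x) {i : Fin (l + 1)}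
    (hi : i ≠ Fin.last l) {a : R} (ha : a ∈ maximalIdeal R)
    (hm : maximalIdeal R ≤ Ideal.span {a} ⊔ (Ideal.span (x '' {j | j ≠ i})).colon {x i}) :
    (Ideal.span (x '' {j | j ≠ i})).colon {x i} ≤ Ideal.span (x '' {j | j ≠ i}) := by
  classical
  by_contra hU
  set Y := Ideal.span (x '' {j | j ≠ i}) with hY
  have hlast : Ideal.span (x '' {j | Fin.last l < j}) = ⊥ := by
    simp [Fin.not_lt.mpr (Fin.le_last _)]
  let b : Ideal R := Y.colon (Y.colon {x i} : Ideal R)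
  have hb : ∀ c, c ∈ b ↔ ∀ v, v * x i ∈ Y → c * v ∈ Y := fun c => by
    simp only [b, Submodule.mem_colon, SetLike.mem_coe, smul_eq_mul,
      Set.mem_singleton_iff, forall_eq]
  let y := x ∘ Equiv.swap i (Fin.last l)
  have hyr : Set.range y = Set.range x := (Equiv.swap i (Fin.last l)).surjective.range_comp x
  have hyY : Ideal.span (y '' {j | j < Fin.last l}) = Y := by
    rw [hY]
    congr 1
    rw [Set.image_comp]
    congr 1
    ext j
    rw [Equiv.image_eq_preimage_symm]
    simp only [Set.mem_preimage, Set.mem_ofPred_eq, Equiv.symm_swap, Fin.lt_last_iff_ne_last]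
    rw [not_iff_not, Equiv.swap_apply_eq_iff, Equiv.swap_apply_right]
  have hsop : IsSOP R (R ⧸ ((Ideal.span (x '' {j | Fin.last l < j})) • (⊤ : Submodule R R))) y := by
    refine isSOP_quotient ?_ (fun j => hx.1.2.1 _) ?_
    · rw [hlast, ← hx.1.ringKrullDim_eq]
      exact ringKrullDim_eq_of_ringEquiv (RingEquiv.quotientBot R)
    · rw [hlast, bot_sup_eq, hyr]
      exact hx.1.isFiniteLength_quotient
  have hbb : bIdeal R (R ⧸ ((Ideal.span (x '' {j | Fin.last l < j})) • (⊤ : Submodule R R))) ≤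
      b := by
    intro c hc
    rw [hb]
    intro v hv
    have := mul_mem_of_mem_bIdeal hsop (Fin.last l) (c := c) (v := v) hc
    rw [hyY, hlast, bot_sup_eq] at this
    exact this (by simpa [y] using hv)
  let w : Fin (l + 1) → ℕ := fun j => if j = i then 1 else 2
  refine false_of_forall_mul_mem_weightIdeal hx.1.ringKrullDim_eq.ge hx.1.mem_maximalIdeal
    hx.1.maximalIdeal_le_radical (i := i) (j := Fin.last l) hi.symm ha hm (w := w)
    (fun j => by simp only [w]; split_ifs <;> omega) (by simp [w]) (by simp [w, hi.symm]) (b := b)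
    ?_ ((hb _).mpr fun v hv => by rwa [mul_comm]) (Ideal.pow_right_mono hbb 3 (hx.2 _)) (N := 1) ?_
  · intro h
    refine hU fun v hv => ?_
    have := (hb 1).mp (h ▸ trivial) v (Submodule.mem_colon_singleton.mp hv)
    rwa [one_mul] at this
  · intro c hc hbc v hv
    obtain ⟨r, u, hu, rfl⟩ := Ideal.mem_span_singleton_sup.mp (hbc hv)
    have h1 : c ^ 1 * (r * c + u) = r * c ^ 2 + c * u := by ring
    rw [h1]
    refine Ideal.add_mem _ (Ideal.mul_mem_left _ _ ?_) ?_
    · have := mem_weightIdeal_single (Function.update x i c) w i 2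
      simpa [w] using this
    · refine Ideal.span_le.mpr ?_ ((hb c).mp hc u (Submodule.mem_colon_singleton.mp hu))
      rintro _ ⟨k, hk, rfl⟩
      have := mem_weightIdeal_single (Function.update x i c) w k 1
      simpa [w, show k ≠ i from hk] using this

/-- The colon ideal of a C-system of parameters at the last index. -/
theorem IsCSOP.colon_le_last (hl : 0 < l) {x : Fin (l + 1) → R} (hx : IsCSOP R R x)
    (hnzd : ∀ u, u * x (Fin.last l) = 0 → u = 0) {a : R} (ha : a ∈ maximalIdeal R)
    (hm : maximalIdeal R ≤
      Ideal.span {a} ⊔ (Ideal.span (x '' {j | j ≠ Fin.last l})).colon {x (Fin.last l)}) :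
    (Ideal.span (x '' {j | j ≠ Fin.last l})).colon {x (Fin.last l)} ≤
      Ideal.span (x '' {j | j ≠ Fin.last l}) := by
  classical
  by_contra hU
  set Y := Ideal.span (x '' {j | j ≠ Fin.last l}) with hY
  have hset : {j : Fin (l + 1) | j ≠ Fin.last l} = {j | j < Fin.last l} := by
    ext j
    exact Fin.lt_last_iff_ne_last.symm
  let P : Fin (l + 1) → Ideal R := fun k =>
    Ideal.span {x (Fin.last l)} ⊔ Ideal.span (x '' {j | j < k})
  let b : Ideal R := ⨅ (k : Fin (l + 1)) (_ : k ≠ Fin.last l),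
    (P k).colon ((P k).colon {x k} : Ideal R)
  have hb : ∀ c, c ∈ b ↔ ∀ k, k ≠ Fin.last l → ∀ v, v * x k ∈ P k → c * v ∈ P k := fun c => by
    simp only [b, Submodule.mem_iInf, Submodule.mem_colon, SetLike.mem_coe, smul_eq_mul,
      Set.mem_singleton_iff, forall_eq]
  obtain ⟨l, rfl⟩ : ∃ l', l = l' + 1 := ⟨l - 1, by omega⟩
  let j : Fin (l + 1 + 1) := (Fin.last l).castSucc
  have hj : j ≠ Fin.last (l + 1) := (Fin.castSucc_lt_last _).ne
  have hsetj : x '' {k | j < k} = {x (Fin.last (l + 1))} := by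
    have : {k | j < k} = {Fin.last (l + 1)} := by
      ext k
      simp only [j, Set.mem_ofPred_eq, Set.mem_singleton_iff, Fin.lt_def, Fin.ext_iff,
        Fin.val_castSucc, Fin.val_last]
      omega
    rw [this, Set.image_singleton]
  let y : Fin (l + 1) → R := fun k => x k.castSucc
  have hsup : Ideal.span {x (Fin.last (l + 1))} ⊔ Ideal.span (Set.range y) =
      Ideal.span (Set.range x) := by
    rw [← Ideal.span_union]
    congr 1
    ext r
    simp only [Set.mem_union, Set.mem_singleton_iff, Set.mem_range, Fin.exists_fin_succ', y]
    tauto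
  have hdimq : ringKrullDim (R ⧸ Ideal.span {x (Fin.last (l + 1))}) =
      ((l + 1 : ℕ) : WithBot ℕ∞) := by
    refine le_antisymm ?_ ?_
    · refine (ringKrullDim_quotient_le_card ?_ (Finset.univ.image y) ?_ ?_).trans
        (Nat.cast_le.mpr (Finset.card_image_le.trans (by simp)))
      · exact ((Ideal.span_singleton_le_iff_mem _).mpr (hx.1.mem_maximalIdeal _)).trans_lt
          (lt_top_iff_ne_top.mpr (maximalIdeal.isMaximal R).ne_top) |>.ne
      · intro r hr
        obtain ⟨k, -, rfl⟩ := Finset.mem_image.mp hr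
        exact hx.1.mem_maximalIdeal _
      · rw [Finset.coe_image, Finset.coe_univ, Set.image_univ, hsup]
        exact hx.1.maximalIdeal_le_radical
    · have h1 := ringKrullDim_le_ringKrullDim_quotient_add_card (R := R)
        {x (Fin.last (l + 1))} (by
          simpa [ringJacobson_eq_maximalIdeal] using hx.1.mem_maximalIdeal (Fin.last (l + 1)))
      rw [hx.1.ringKrullDim_eq, Finset.coe_singleton, Finset.card_singleton] at h1
      push_cast at h1 ⊢
      exact (ENat.WithBot.add_le_add_one_right_iff).mp h1
  have hyim : ∀ k : Fin (l + 1), y '' {j | j < k} = x '' {j | j < k.castSucc} := by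
    intro k
    ext r
    constructor
    · rintro ⟨k', hk', rfl⟩
      exact ⟨k'.castSucc, Fin.castSucc_lt_castSucc_iff.mpr hk', rfl⟩
    · rintro ⟨k', hk', rfl⟩
      refine ⟨k'.castPred (hk'.trans_le (Fin.le_last _)).ne, ?_, by simp [y]⟩
      exact Fin.castPred_lt_iff .. |>.mpr hk'
  have hsop : IsSOP R (R ⧸ ((Ideal.span (x '' {k | j < k})) • (⊤ : Submodule R R))) y := by
    rw [hsetj]
    refine isSOP_quotient hdimq (fun k => hx.1.2.1 _) ?_
    rw [hsup]
    exact hx.1.isFiniteLength_quotient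
  have hbb : bIdeal R (R ⧸ ((Ideal.span (x '' {k | j < k})) • (⊤ : Submodule R R))) ≤
      b := by
    intro c hc
    rw [hb]
    intro k hk v hv
    obtain ⟨k, rfl⟩ := Fin.exists_castSucc_eq.mpr hk
    have := mul_mem_of_mem_bIdeal hsop k (c := c) (v := v) hc
    rw [hyim, hsetj] at this
    exact this hv
  let w : Fin (l + 1 + 1) → ℕ := fun k => l + 2 - k
  refine false_of_forall_mul_mem_weightIdeal hx.1.ringKrullDim_eq.ge hx.1.mem_maximalIdeal
    hx.1.maximalIdeal_le_radical (i := Fin.last (l + 1)) (j := j) hj ha hm (w := w)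
    (fun k => by simp only [w]; omega) (by simp [w]) (by simp [w, j]) (b := b)
    ?_ ((hb _).mpr fun k hk v hv => Ideal.mul_mem_right _ _
      (Ideal.mem_sup_left (Ideal.mem_span_singleton_self _)))
    (Ideal.pow_right_mono hbb 3 (hx.2 _)) (N := l + 1) ?_
  · intro h
    refine hU fun v hv => ?_
    rw [Submodule.mem_colon_singleton, hY, hset, smul_eq_mul] at hv
    have := pow_mul_mem_of_mul_mem_span hnzd ((hb 1).mp (h ▸ trivial)) (K := Y)
      (fun k hk => by
        rw [one_pow, one_mul]
        exact Ideal.subset_span ⟨k, hk, rfl⟩) hv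
    rwa [one_pow, one_mul] at this
  · intro c hc hbc v hv
    obtain ⟨r, u, hu, rfl⟩ := Ideal.mem_span_singleton_sup.mp (hbc hv)
    rw [Submodule.mem_colon_singleton, hset, smul_eq_mul] at hu
    have hcw : ∀ n, c ^ n ∈ weightIdeal (Function.update x (Fin.last (l + 1)) c) w n := fun n => by
      have := mem_weightIdeal_single (Function.update x (Fin.last (l + 1)) c) w (Fin.last (l + 1)) n
      simpa [w] using this
    have h1 : c ^ (l + 1) * (r * c + u) = r * c ^ (l + 1 + 1) + c ^ (l + 1) * u := by ring
    rw [h1]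
    refine Ideal.add_mem _ (Ideal.mul_mem_left _ _ (hcw _)) ?_
    refine pow_mul_mem_of_mul_mem_span hnzd ((hb c).mp hc) (fun k hk => ?_) hu
    have h2 := mem_weightIdeal_single (Function.update x (Fin.last (l + 1)) c) w k 1
    have h3 := weightIdeal_mul_le _ _ _ _ (Ideal.mul_mem_mul (hcw k) h2)
    have h4 : (k : ℕ) + w k * 1 = l + 1 + 1 := by
      simp only [w]; omega
    rw [h4] at h3
    simpa [hk] using h3

end CSystem

section MonomialLength

variable {R : Type*} [CommRing R] {d : ℕ}

theorem monomialIdeal_le_pow (z : Fin d → R) {S : Set (Fin d → ℕ)} {k : ℕ}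
    (hS : ∀ α ∈ S, k ≤ ∑ i, α i) : monomialIdeal z S ≤ Ideal.span (Set.range z) ^ k := by
  refine Ideal.span_le.mpr ?_
  rintro _ ⟨α, hα, rfl⟩
  refine Ideal.pow_le_pow_right (hS α hα) ?_
  rw [← Finset.prod_pow_eq_pow_sum]
  exact Ideal.prod_mem_prod fun i _ =>
    Ideal.pow_mem_pow (Ideal.subset_span (Set.mem_range_self i)) _

theorem mul_prod_pow_mem_monomialIdeal (z : Fin d → R) {S : Set (Fin d → ℕ)} {α : Fin d → ℕ}
    (h : ∀ i, α + Pi.single i 1 ∈ S) {r : R} (hr : r ∈ Ideal.span (Set.range z)) :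
    r * ∏ i, z i ^ α i ∈ monomialIdeal z S := by
  induction hr using Submodule.span_induction with
  | mem x hx =>
    obtain ⟨i, rfl⟩ := hx
    have := prod_pow_mem_monomialIdeal z (h i)
    simp only [Pi.add_apply, pow_add, Finset.prod_mul_distrib] at this
    rwa [prod_pow_single, pow_one, mul_comm] at this
  | zero => simp
  | add x y _ _ hx hy => rw [add_mul]; exact Ideal.add_mem _ hx hy
  | smul a x _ hx => rw [smul_eq_mul, mul_assoc]; exact Ideal.mul_mem_left _ _ hx

/-- Splitting off the part of degree `k` of an element of a monomial ideal. -/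
theorem exists_sub_aeval_mem_monomialIdeal (z : Fin d → R) {S : Set (Fin d → ℕ)} {k : ℕ}
    (hk : ∀ α ∈ S, k ≤ ∑ i, α i) {y : R} (hy : y ∈ monomialIdeal z S) :
    ∃ F : MvPolynomial (Fin d) R, F.IsHomogeneous k ∧ (∀ β, F.coeff β ≠ 0 → ⇑β ∈ S) ∧
      y - MvPolynomial.aeval z F ∈ monomialIdeal z (S ∩ {α | k + 1 ≤ ∑ i, α i}) := by
  induction hy using Submodule.span_induction with
  | mem x hx =>
    obtain ⟨α, hα, rfl⟩ := hx
    rcases (hk α hα).eq_or_lt with h | h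
    · refine ⟨MvPolynomial.monomial (Finsupp.equivFunOnFinite.symm α) 1, ?_, fun β hβ => ?_, ?_⟩
      · apply MvPolynomial.isHomogeneous_monomial
        simp [Finsupp.degree_eq_sum, h]
      · rw [MvPolynomial.coeff_monomial, ne_eq, ite_eq_right_iff, not_forall] at hβ
        obtain ⟨rfl, -⟩ := hβ
        exact hα
      · simp [MvPolynomial.aeval_monomial, Finsupp.prod_fintype]
    · refine ⟨0, MvPolynomial.isHomogeneous_zero _ _ _, by simp, ?_⟩
      rw [map_zero, sub_zero]
      exact prod_pow_mem_monomialIdeal z ⟨hα, h⟩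
  | zero => exact ⟨0, MvPolynomial.isHomogeneous_zero _ _ _, by simp, by simp⟩
  | add x y _ _ hx hy =>
    obtain ⟨F, hF, hFS, hFx⟩ := hx
    obtain ⟨G, hG, hGS, hGy⟩ := hy
    refine ⟨F + G, hF.add hG, fun β hβ => ?_, ?_⟩
    · by_cases h : F.coeff β = 0
      · exact hGS β fun h' => hβ (by rw [MvPolynomial.coeff_add, h, h', add_zero])
      · exact hFS β h
    · convert Ideal.add_mem _ hFx hGy using 1
      rw [map_add]; ring
  | smul a x _ hx =>
    obtain ⟨F, hF, hFS, hFx⟩ := hx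
    refine ⟨MvPolynomial.C a * F, hF.C_mul a, fun β hβ => hFS β fun h => hβ ?_, ?_⟩
    · rw [MvPolynomial.coeff_C_mul, h, mul_zero]
    · convert Ideal.mul_mem_left _ a hFx using 1
      rw [map_mul, MvPolynomial.aeval_C, Algebra.algebraMap_self_apply, smul_eq_mul]; ring

variable [IsLocalRing R] [IsNoetherianRing R]

/-- In a local ring whose maximal ideal is generated by a system of parameters `z`,
monomials in `z` lie only in the obvious monomial ideals. -/
theorem prod_pow_notMem_monomialIdeal (hd : (d : WithBot ℕ∞) ≤ ringKrullDim R) {z : Fin d → R}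
    (hz : maximalIdeal R = Ideal.span (Set.range z)) {S : Set (Fin d → ℕ)} (hS : IsUpperSet S)
    {α : Fin d → ℕ} (hα : α ∉ S) : ∏ i, z i ^ α i ∉ monomialIdeal z S := by
  intro h
  have hzm : ∀ i, z i ∈ maximalIdeal R := fun i => hz ▸ Ideal.subset_span (Set.mem_range_self i)
  have hrad : maximalIdeal R ≤ (Ideal.span (Set.range z)).radical := hz.le.trans Ideal.le_radical
  have key : ∀ k ≤ ∑ i, α i, ∏ i, z i ^ α i ∈ monomialIdeal z (S ∩ {β | k ≤ ∑ i, β i}) := by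
    intro k
    induction k with
    | zero => intro _; simpa using h
    | succ k ih =>
      intro hk
      obtain ⟨F, hF, hFS, hF'⟩ := exists_sub_aeval_mem_monomialIdeal z (fun β hβ => hβ.2)
        (ih (by omega))
      rw [Set.inter_assoc, ← Set.ofPred_and] at hF'
      have hF1 : MvPolynomial.aeval z F ∈ Ideal.span (Set.range z) ^ (k + 1) := by
        have h1 := monomialIdeal_le_pow z (fun β hβ => hβ.2.2) hF'
        have h2 : ∏ i, z i ^ α i ∈ Ideal.span (Set.range z) ^ (k + 1) :=
          monomialIdeal_le_pow z (S := {α}) (by simpa using hk)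
            (prod_pow_mem_monomialIdeal z (Set.mem_singleton α))
        simpa using Ideal.sub_mem _ h2 h1
      have hcoef : ∀ β, F.coeff β ∈ maximalIdeal R := fun β => by
        by_contra hβ
        exact prod_pow_notMem_mul_pow hd z hzm hrad F hF hβ (span_pow_succ_le_mul z hzm k hF1)
      have hF2 : MvPolynomial.aeval z F ∈ monomialIdeal z (S ∩ {β | k + 1 ≤ ∑ i, β i}) := by
        rw [MvPolynomial.aeval_def, MvPolynomial.eval₂_eq']
        refine Ideal.sum_mem _ fun β hβ => ?_
        have hβS := hFS β (MvPolynomial.mem_support_iff.mp hβ)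
        refine mul_prod_pow_mem_monomialIdeal z (S := S ∩ {β | k + 1 ≤ ∑ i, β i})
          (fun i => ⟨hS le_self_add hβS.1, ?_⟩) (hz ▸ hcoef β)
        have := hβS.2
        simp only [Set.mem_ofPred_eq, Pi.add_apply, Finset.sum_add_distrib,
          Finset.sum_pi_single', Finset.mem_univ, if_true] at this ⊢
        simpa using this
      have := Ideal.add_mem _ (monomialIdeal_mono z (T := S ∩ {β | k + 1 ≤ ∑ i, β i})
        (fun β hβ => ⟨hβ.1, hβ.2.2⟩) hF') hF2
      simpa using this
  obtain ⟨F, hF, hFS, hF'⟩ := exists_sub_aeval_mem_monomialIdeal z (fun β hβ => hβ.2) (key _ le_rfl)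
  have hG : (MvPolynomial.monomial (Finsupp.equivFunOnFinite.symm α) (1 : R)).IsHomogeneous
      (∑ i, α i) := by
    apply MvPolynomial.isHomogeneous_monomial
    simp [Finsupp.degree_eq_sum]
  refine prod_pow_notMem_mul_pow hd z hzm hrad _ (hG.sub hF)
    (α := Finsupp.equivFunOnFinite.symm α) ?_ (span_pow_succ_le_mul z hzm (∑ i, α i) ?_)
  · have : F.coeff (Finsupp.equivFunOnFinite.symm α) = 0 := by
      by_contra h
      exact hα (hFS _ h).1
    simp [MvPolynomial.coeff_sub, this]
  · convert monomialIdeal_le_pow z (fun β hβ => hβ.2) hF' using 1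
    rw [map_sub]
    simp [MvPolynomial.aeval_monomial, Finsupp.prod_fintype]

/-- The length of the quotient by a monomial ideal is the number of monomials outside of it. -/
theorem length_quotient_monomialIdeal (hd : (d : WithBot ℕ∞) ≤ ringKrullDim R) {z : Fin d → R}
    (hz : maximalIdeal R = Ideal.span (Set.range z)) (T : Finset (Fin d → ℕ))
    (hT : IsLowerSet (T : Set (Fin d → ℕ))) :
    Module.length R (R ⧸ monomialIdeal z (T : Set (Fin d → ℕ))ᶜ) = T.card := by
  classical
  induction hn : T.card generalizing T with
  | zero =>
    rw [Finset.card_eq_zero] at hn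
    subst hn
    have : monomialIdeal z ((∅ : Finset (Fin d → ℕ)) : Set (Fin d → ℕ))ᶜ = ⊤ := by
      rw [Ideal.eq_top_iff_one]
      simpa using prod_pow_mem_monomialIdeal z
        (S := ((∅ : Finset (Fin d → ℕ)) : Set (Fin d → ℕ))ᶜ) (α := 0) (by simp)
    rw [this, Nat.cast_zero, Module.length_eq_zero_iff]
    exact Ideal.Quotient.subsingleton_iff.mpr rfl
  | succ n ih =>
    obtain ⟨α, hα⟩ := T.exists_maximal (Finset.card_pos.mp (by omega))
    set I := monomialIdeal z (T : Set (Fin d → ℕ))ᶜ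
    set I' := monomialIdeal z (T.erase α : Set (Fin d → ℕ))ᶜ
    have hle : I ≤ I' := monomialIdeal_mono z (Set.compl_subset_compl.mpr (by simp))
    have hlow : IsLowerSet (T.erase α : Set (Fin d → ℕ)) := by
      intro β γ hγ hβ
      simp only [Finset.coe_erase, Set.mem_sdiff, Finset.mem_coe, Set.mem_singleton_iff] at hβ ⊢
      refine ⟨hT hγ hβ.1, ?_⟩
      rintro rfl
      exact hβ.2 (hα.eq_of_ge hβ.1 hγ)
    rw [length_quotient_eq_add hle, ih (T.erase α) hlow (by
      rw [Finset.card_erase_of_mem hα.prop, hn]; rfl), add_comm, Nat.cast_add, Nat.cast_one]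
    congr 1
    have hI' : I' = Ideal.span {∏ i, z i ^ α i} ⊔ I := by
      simp only [I', I, monomialIdeal]
      rw [← Ideal.span_union, ← Set.image_singleton (f := fun α : Fin d → ℕ => ∏ i, z i ^ α i),
        ← Set.image_union]
      congr 2
      ext β
      simp
      tauto
    have hmap : Submodule.map (Submodule.mkQ I) I' = Submodule.span R {I.mkQ (∏ i, z i ^ α i)} := by
      rw [hI', Submodule.map_sup, Submodule.mkQ_map_self I, sup_bot_eq,
        Ideal.span, Submodule.map_span, Set.image_singleton]
    have hann : Ideal.torsionOf R (R ⧸ I) (I.mkQ (∏ i, z i ^ α i)) = maximalIdeal R := by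
      symm
      refine (maximalIdeal.isMaximal R).eq_of_le ?_ fun r hr => ?_
      · rw [Ne, Ideal.eq_top_iff_one, Ideal.mem_torsionOf_iff, one_smul, Submodule.mkQ_apply,
          Submodule.Quotient.mk_eq_zero]
        exact prod_pow_notMem_monomialIdeal hd hz hT.compl (by simpa using hα.prop)
      · rw [Ideal.mem_torsionOf_iff, ← map_smul, Submodule.mkQ_apply,
          Submodule.Quotient.mk_eq_zero]
        refine mul_prod_pow_mem_monomialIdeal z (fun i hi => ?_) (hz ▸ hr)
        have := congrFun (hα.eq_of_ge hi le_self_add) i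
        simp at this
    rw [hmap, ← (Ideal.quotTorsionOfEquivSpanSingleton R _ _).length_eq, hann,
      Module.length_eq_one_iff, isSimpleModule_iff_isCoatom]
    exact (maximalIdeal.isMaximal R).out

end MonomialLength

section PowerLength

variable {d : ℕ}

/-- Adding a slack variable. -/
def sumLeEquiv (d n : ℕ) :
    {α : Fin d → ℕ // ∑ i, α i ≤ n} ≃ {α : Fin (d + 1) → ℕ // ∑ i, α i = n} where
  toFun α := ⟨Fin.cons (n - ∑ i, α.1 i) α.1, by
    have := α.2
    simp only [Fin.sum_univ_succ, Fin.cons_zero, Fin.cons_succ]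
    omega⟩
  invFun α := ⟨Fin.tail α.1, by
    have := α.2
    rw [Fin.sum_univ_succ] at this
    simp only [Fin.tail]
    omega⟩
  left_inv α := by simp
  right_inv α := by
    have := α.2
    rw [Fin.sum_univ_succ] at this
    refine Subtype.ext ?_
    conv_rhs => rw [← Fin.cons_self_tail α.1]
    simp only [Fin.tail]
    congr 1
    omega

/-- Division with remainder in each coordinate. -/
def divModEquiv (v : Fin d → ℕ) (hv : ∀ i, 0 < v i) (n : ℕ) :
    {α : Fin d → ℕ // ∑ i, α i / v i ≤ n} ≃
      (∀ i, Fin (v i)) × {α : Fin d → ℕ // ∑ i, α i ≤ n} where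
  toFun α := (fun i => ⟨α.1 i % v i, Nat.mod_lt _ (hv i)⟩, ⟨fun i => α.1 i / v i, α.2⟩)
  invFun p := ⟨fun i => p.1 i + v i * p.2.1 i, by
    have : ∀ i, ((p.1 i : ℕ) + v i * p.2.1 i) / v i = p.2.1 i := fun i => by
      rw [Nat.add_mul_div_left _ _ (hv i), Nat.div_eq_of_lt (p.1 i).2, zero_add]
    simpa only [this] using p.2.2⟩
  left_inv α := Subtype.ext (funext fun i => Nat.mod_add_div _ _)
  right_inv p := by
    refine Prod.ext (funext fun i => Fin.ext ?_) (Subtype.ext (funext fun i => ?_))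
    · simp [Nat.mod_eq_of_lt]
    · simp only
      rw [Nat.add_mul_div_left _ _ (hv i), Nat.div_eq_of_lt (p.1 i).2, zero_add]

theorem card_sum_div_le (v : Fin d → ℕ) (hv : ∀ i, 0 < v i) (n : ℕ) :
    {α : Fin d → ℕ | ∑ i, α i / v i ≤ n}.Finite ∧
      {α : Fin d → ℕ | ∑ i, α i / v i ≤ n}.ncard = (∏ i, v i) * (n + d).choose d := by
  let E := (divModEquiv v hv n).trans
    (Equiv.prodCongr (Equiv.refl _) ((sumLeEquiv d n).trans (Sym.equivNatSumOfFintype _ n).symm))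
  refine ⟨Set.finite_coe_iff.mp (Finite.of_equiv _ E.symm), ?_⟩
  refine (Nat.card_coe_set_eq _).symm.trans ((Nat.card_congr E).trans ?_)
  rw [Nat.card_prod, Nat.card_pi, Nat.card_eq_fintype_card,
    Sym.card_sym_eq_choose, Fintype.card_fin]
  simp only [Nat.card_eq_fintype_card, Fintype.card_fin]
  rw [show d + 1 + n - 1 = n + d by omega, Nat.choose_symm_add]

variable {R : Type*} [CommRing R]

theorem span_pow_eq_monomialIdeal (z : Fin d → R) (v : Fin d → ℕ) (hv : ∀ i, 0 < v i) (n : ℕ) :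
    Ideal.span (Set.range fun i => z i ^ v i) ^ n =
      monomialIdeal z {α | n ≤ ∑ i, α i / v i} := by
  refine le_antisymm ?_ (Ideal.span_le.mpr ?_)
  · induction n with
    | zero =>
      refine le_top.trans (Ideal.eq_top_iff_one _ |>.mpr ?_).ge
      simpa using prod_pow_mem_monomialIdeal z (S := {α | 0 ≤ ∑ i, α i / v i}) (α := 0)
    | succ n ih =>
      have h1 : Ideal.span (Set.range fun i => z i ^ v i) ≤
          monomialIdeal z {α | 1 ≤ ∑ i, α i / v i} := by
        refine Ideal.span_le.mpr ?_
        rintro _ ⟨i, rfl⟩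
        have := prod_pow_mem_monomialIdeal z (S := {α | 1 ≤ ∑ i, α i / v i})
          (α := Pi.single i (v i)) (by
            refine le_trans ?_ (Finset.single_le_sum (fun _ _ => Nat.zero_le _) (Finset.mem_univ i))
            rw [Pi.single_eq_same, Nat.div_self (hv i)])
        rwa [prod_pow_single] at this
      rw [pow_succ]
      refine (Ideal.mul_mono ih h1).trans ?_
      rw [monomialIdeal_mul]
      refine monomialIdeal_mono z ?_
      rintro _ ⟨α, hα, β, hβ, rfl⟩
      simp only [Set.mem_ofPred_eq, Pi.add_apply] at *
      have : ∑ i, α i / v i + ∑ i, β i / v i ≤ ∑ i, (α i + β i) / v i := by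
        rw [← Finset.sum_add_distrib]
        exact Finset.sum_le_sum fun i _ => Nat.div_add_div_le_add_div
      omega
  · rintro _ ⟨α, hα, rfl⟩
    refine Ideal.pow_le_pow_right hα ?_
    rw [← Finset.prod_pow_eq_pow_sum]
    refine Ideal.prod_mem_prod fun i _ => ?_
    rw [show z i ^ α i = (z i ^ v i) ^ (α i / v i) * z i ^ (α i % v i) by
      rw [← pow_mul, ← pow_add, Nat.div_add_mod]]
    exact Ideal.mul_mem_right _ _ (Ideal.pow_mem_pow (Ideal.subset_span (Set.mem_range_self i)) _)

variable [IsLocalRing R] [IsNoetherianRing R]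

/-- The Hilbert function of an ideal generated by powers of a regular system of parameters. -/
theorem length_quotient_span_pow (hd : (d : WithBot ℕ∞) ≤ ringKrullDim R) {z : Fin d → R}
    (hz : maximalIdeal R = Ideal.span (Set.range z)) (v : Fin d → ℕ) (hv : ∀ i, 0 < v i) (n : ℕ) :
    Module.length R (R ⧸ Ideal.span (Set.range fun i => z i ^ v i) ^ (n + 1)) =
      ((∏ i, v i) * (n + d).choose d : ℕ) := by
  obtain ⟨hfin, hcard⟩ := card_sum_div_le v hv n
  have hlow : IsLowerSet {α : Fin d → ℕ | ∑ i, α i / v i ≤ n} := fun α β hβ hα =>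
    (Finset.sum_le_sum fun i _ => Nat.div_le_div_right (hβ i)).trans hα
  have := length_quotient_monomialIdeal hd hz hfin.toFinset (by simpa using hlow)
  rw [← Set.ncard_eq_toFinset_card _ hfin, hcard, hfin.coe_toFinset] at this
  rw [← this, span_pow_eq_monomialIdeal z v hv,
    show {α : Fin d → ℕ | n + 1 ≤ ∑ i, α i / v i} = {α | ∑ i, α i / v i ≤ n}ᶜ by ext α; simp]

end PowerLength

section RegularChern

variable {R : Type u} [CommRing R] [IsLocalRing R] [IsNoetherianRing R]

theorem IsHilbCoeff.one_eq_zero {s : ℕ} (hd : ((s + 1 : ℕ) : WithBot ℕ∞) ≤ ringKrullDim R)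
    {z : Fin (s + 1) → R} (hz : maximalIdeal R = Ideal.span (Set.range z)) (v : Fin (s + 1) → ℕ)
    {e : ℕ → ℤ} (he : IsHilbCoeff R (Ideal.span (Set.range fun i => z i ^ v i)) (s + 1) e) :
    e 1 = 0 := by
  obtain ⟨N, hN⟩ := he.length_eq
  refine eq_zero_of_binomialSum_eq (s := s) (N := N) (c := ∏ i, (v i : ℤ)) fun n hn => ?_
  obtain ⟨L, hL, hL'⟩ := hN n hn
  rw [← hL']
  by_cases hv : ∀ i, 0 < v i
  · rw [length_quotient_span_pow hd hz v hv] at hL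
    have : (∏ i, v i) * (n + (s + 1)).choose (s + 1) = L := by exact_mod_cast hL
    rw [← this]
    push_cast
    rfl
  · push Not at hv
    obtain ⟨i, hi⟩ := hv
    have hi : v i = 0 := by omega
    have htop : Ideal.span (Set.range fun i => z i ^ v i) = ⊤ :=
      (Ideal.eq_top_iff_one _).mpr (Ideal.subset_span ⟨i, by simp [hi]⟩)
    rw [Finset.prod_eq_zero (Finset.mem_univ i) (by simp [hi]), zero_mul]
    rw [htop, ← Ideal.one_eq_top, one_pow, Ideal.one_eq_top,
      Module.length_eq_zero_iff.mpr (Ideal.Quotient.subsingleton_iff.mpr rfl)] at hL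
    exact_mod_cast hL.symm

end RegularChern

section RegularCase

variable {R : Type u} [CommRing R]

theorem span_update_pow {d : ℕ} (x : Fin d → R) (i : Fin d) (a : R) (k : ℕ) :
    Ideal.span (Set.range fun j =>
        Function.update x i a j ^ Function.update (1 : Fin d → ℕ) i k j) =
      Ideal.span {a ^ k} ⊔ Ideal.span (x '' {j | j ≠ i}) := by
  rw [← Ideal.span_union]
  congr 1
  ext r
  simp only [Set.mem_range, Set.mem_union, Set.mem_singleton_iff, Set.mem_image,
    Set.mem_ofPred_eq]
  constructor
  · rintro ⟨j, rfl⟩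
    by_cases hj : j = i
    · subst hj; simp
    · exact Or.inr ⟨j, hj, by simp [hj]⟩
  · rintro (rfl | ⟨j, hj, rfl⟩)
    · exact ⟨i, by simp⟩
    · exact ⟨j, by simp [hj]⟩

variable [IsLocalRing R] [IsNoetherianRing R]

/-- If the maximal ideal is generated by `a` and all but the `i`-th element of a system of
parameters `x`, then ideals containing these elements have vanishing Chern number. -/
theorem IsHilbCoeff.one_eq_zero_of_le {s : ℕ} (hd : ((s + 1 : ℕ) : WithBot ℕ∞) ≤ ringKrullDim R)
    {x : Fin (s + 1) → R} (hx : ∀ j, x j ∈ maximalIdeal R) {i : Fin (s + 1)} {a : R}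
    (ha : a ∈ maximalIdeal R)
    (hm : maximalIdeal R ≤ Ideal.span {a} ⊔ Ideal.span (x '' {j | j ≠ i})) {b : Ideal R}
    (hb : Ideal.span (x '' {j | j ≠ i}) ≤ b) (hb' : ¬ b ≤ Ideal.span (x '' {j | j ≠ i}))
    {e : ℕ → ℤ} (he : IsHilbCoeff R b (s + 1) e) : e 1 = 0 := by
  obtain ⟨c, v, hcb, -, hbv, r, hr, hc⟩ := exists_mem_le_span_singleton_sup ha hm hb'
  have hav : a ^ v ∈ b := by
    obtain ⟨r, rfl⟩ := hr
    have h1 : (r : R) * a ^ v ∈ b := by simpa using Ideal.sub_mem _ hcb (hb hc)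
    simpa using Ideal.mul_mem_left _ (↑r⁻¹ : R) h1
  have hbeq : b = Ideal.span {a ^ v} ⊔ Ideal.span (x '' {j | j ≠ i}) :=
    le_antisymm hbv (sup_le ((Ideal.span_singleton_le_iff_mem _).mpr hav) hb)
  rw [hbeq, ← span_update_pow] at he
  refine IsHilbCoeff.one_eq_zero hd ?_ _ he
  have h1 := span_update_pow x i a 1
  rw [pow_one, show Function.update (1 : Fin (s + 1) → ℕ) i 1 = 1 from Function.update_eq_self i 1]
    at h1
  simp only [Pi.one_apply, pow_one] at h1
  rw [h1]
  refine le_antisymm hm (sup_le ((Ideal.span_singleton_le_iff_mem _).mpr ha) (Ideal.span_le.mpr ?_))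
  rintro _ ⟨j, -, rfl⟩
  exact hx j

theorem IsCSOP.chern_sub_le {l : ℕ} (hl : 0 < l) {x : Fin (l + 1) → R} (hx : IsCSOP R R x)
    (hnzd : ∀ u, u * x (Fin.last l) = 0 → u = 0) {e e' f : ℕ → ℤ}
    (he : IsHilbCoeff R (colonIdeal R (Ideal.span (Set.range x))) (l + 1) e)
    (he' : IsHilbCoeff R (Ideal.span (Set.range x)) (l + 1) e')
    (hf : IsIrrCoeff R (Ideal.span (Set.range x)) (l + 1) f) : e 1 - e' 1 ≤ f 0 := by
  classical
  set q := Ideal.span (Set.range x) with hq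
  by_cases h : maximalIdeal R * colonIdeal R q ≤ maximalIdeal R * q
  · exact chern_sub_le_of_mul_le h he he' hf
  rw [Ideal.mul_le] at h
  push Not at h
  obtain ⟨a, ha, y, hy, hay⟩ := h
  have hyq : ∀ r ∈ maximalIdeal R, r * y ∈ q := hy
  obtain ⟨c, hc⟩ := (Ideal.mem_span_range_iff_exists_fun).mp (hyq a ha)
  obtain ⟨i, hi⟩ : ∃ i, c i ∉ maximalIdeal R := by
    by_contra! h
    exact hay (hc ▸ Ideal.sum_mem _ fun j _ =>
      Ideal.mul_mem_mul (h j) (Ideal.subset_span (Set.mem_range_self j)))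
  set Y := Ideal.span (x '' {j | j ≠ i}) with hY
  have hxi : x i ∈ Ideal.span {a * y} ⊔ Y := by
    obtain ⟨r, hr⟩ := (IsLocalRing.notMem_maximalIdeal.mp hi)
    have h1 : c i * x i ∈ Ideal.span {a * y} ⊔ Y := by
      rw [Finset.sum_eq_add_sum_sdiff_singleton_of_mem (Finset.mem_univ i)] at hc
      rw [eq_sub_of_add_eq hc]
      refine Ideal.sub_mem _ (Ideal.mem_sup_left (Ideal.mem_span_singleton_self _))
        (Ideal.mem_sup_right (Ideal.sum_mem _ fun j hj => Ideal.mul_mem_left _ _ ?_))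
      exact Ideal.subset_span ⟨j, by simpa using hj, rfl⟩
    rw [← hr] at h1
    simpa using Ideal.mul_mem_left _ (↑r⁻¹ : R) h1
  have hYq : Y ≤ q := Ideal.span_mono (Set.image_subset_range _ _)
  have hqle : q ≤ Ideal.span {a * y} ⊔ Y := by
    refine Ideal.span_le.mpr ?_
    rintro _ ⟨j, rfl⟩
    by_cases hj : j = i
    · exact hj ▸ hxi
    · exact Ideal.mem_sup_right (Ideal.subset_span ⟨j, hj, rfl⟩)
  have hm : maximalIdeal R ≤ Ideal.span {a} ⊔ Y.colon {x i} := by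
    intro r hr
    obtain ⟨s, w, hw, hs⟩ := Ideal.mem_span_singleton_sup.mp (hqle (hyq r hr))
    have h1 : (r - s * a) * y ∈ Y := by
      rwa [show (r - s * a) * y = w by rw [sub_mul, ← hs]; ring]
    obtain ⟨t, w', hw', ht⟩ := Ideal.mem_span_singleton_sup.mp hxi
    refine Ideal.mem_span_singleton_sup.mpr ⟨s, r - s * a, ?_, by ring⟩
    rw [Submodule.mem_colon_singleton, smul_eq_mul, ← ht,
      show (r - s * a) * (t * (a * y) + w') = t * a * ((r - s * a) * y) + (r - s * a) * w' by ring]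
    exact Ideal.add_mem _ (Ideal.mul_mem_left _ _ h1) (Ideal.mul_mem_left _ _ hw')
  have hcolon : Y.colon {x i} ≤ Y := by
    by_cases hil : i = Fin.last l
    · subst hil
      exact hx.colon_le_last hl hnzd ha hm
    · exact hx.colon_le_of_ne_last hil ha hm
  have hm' : maximalIdeal R ≤ Ideal.span {a} ⊔ Y := hm.trans (sup_le_sup_left hcolon _)
  have hd := hx.1.ringKrullDim_eq.ge
  have hqY : ¬ q ≤ Y := fun h => notMem_colon_singleton_self hd hx.1.mem_maximalIdeal
    hx.1.maximalIdeal_le_radical i (Submodule.mem_colon_singleton.mpr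
      (Ideal.mul_mem_left _ _ (h (Ideal.subset_span (Set.mem_range_self i)))))
  have hqJ : q ≤ colonIdeal R q := fun u hu r _ => Ideal.mul_mem_left _ _ hu
  rw [he.one_eq_zero_of_le hd hx.1.mem_maximalIdeal ha hm' (hYq.trans hqJ)
      (fun h => hqY (hqJ.trans h)),
    he'.one_eq_zero_of_le hd hx.1.mem_maximalIdeal ha hm' hYq hqY, sub_self]
  exact hf.zero_le

end RegularCase
/-- If `R` is unmixed of dimension `d ≥ 2`, then for every C-parameter ideal `q`
of `R` one has `e_1(q :_R m, R) - e_1(q, R) ≤ f_0(q, R)`. -/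
theorem statement_2 {R : Type u} [CommRing R] [IsLocalRing R] [IsNoetherianRing R]
    (hres : IsHomImageOfCM R)
    (d : ℕ) (hd : 2 ≤ d) (hdim : ringKrullDim R = (d : WithBot ℕ∞))
    (hum : IsUnmixedRing R)
    (q : Ideal R) (hq : IsCParamIdeal R q)
    (e e' f : ℕ → ℤ)
    (he : IsHilbCoeff R (colonIdeal R q) d e)
    (he' : IsHilbCoeff R q d e')
    (hf : IsIrrCoeff R q d f) :
    e 1 - e' 1 ≤ f 0 := by

  obtain ⟨s, x, hx, rfl⟩ := hq
  have hs : s = d := by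
    have := hx.1.ringKrullDim_eq.symm.trans hdim
    exact_mod_cast this
  subst hs
  obtain ⟨l, rfl⟩ : ∃ l, s = l + 1 := ⟨s - 1, by omega⟩
  classical
  refine hx.chern_sub_le (by omega) (fun u hu => ?_) he he' hf
  refine hum.eq_zero_of_mul_eq_zero (l := l) (x := x (Fin.last l)) ?_
    (Finset.univ.image fun k : Fin l => x k.castSucc) ?_
    (Finset.card_image_le.trans (by simp)) ?_ hu
  · rw [hdim]
    exact_mod_cast l.lt_succ_self
  · intro r hr
    obtain ⟨k, -, rfl⟩ := Finset.mem_image.mp hr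
    exact hx.1.mem_maximalIdeal _
  · refine hx.1.maximalIdeal_le_radical.trans (Ideal.radical_mono (Ideal.span_le.mpr ?_))
    rintro _ ⟨k, rfl⟩
    induction k using Fin.lastCases with
    | last => exact Ideal.mem_sup_left (Ideal.mem_span_singleton_self _)
    | cast k => exact Ideal.mem_sup_right (Ideal.subset_span (by simp))
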